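/- arXiv:1102.4834 — 5 statements merged into one kernel-verified Lean document; each statement's English description precedes it below -/
import Mathlib

section
/- Let a>1, b>1, c>0, r>0, s>0 be integers with gcd(ra, sb)=1. If the equation (-1)^u·r·a^x + (-1)^v·s·b^y = c has three pairwise distinct solutions (x₁,y₁), (x₂,y₂), (x₃,y₃) in positive integers x,y with u,v ∈ {0,1}, then c < (Z·J)², where J = max(a,b) and Z = max(x₁, x₂, x₃, y₁, y₂, y₃). -/
/-- A solution of equation (1): `(-1)^u * r * a^x + (-1)^v * s * b^y = c`
with `x, y` positive integers and `u, v ∈ {0,1}`. -/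
def IsSol (a b c r s : ℤ) (x y : ℕ) : Prop :=
  0 < x ∧ 0 < y ∧ ∃ u v : ℕ, u ≤ 1 ∧ v ≤ 1 ∧
    (-1 : ℤ) ^ u * r * a ^ x + (-1 : ℤ) ^ v * s * b ^ y = c

/-- The absolute difference of two exponents. -/
abbrev gap (m n : ℕ) : ℕ := max m n - min m n

lemma sq_eq_one_of_sign {ε : ℤ} (hε : ε = 1 ∨ ε = -1) : ε * ε = 1 := by
  rcases hε with rfl | rfl <;> norm_num

lemma IsSol.exists_signs {a b c r s : ℤ} {x y : ℕ} (h : IsSol a b c r s x y) :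
    ∃ e f : ℤ, (e = 1 ∨ e = -1) ∧ (f = 1 ∨ f = -1) ∧ e * (r * a ^ x) + f * (s * b ^ y) = c := by
  obtain ⟨-, -, u, v, -, -, h⟩ := h
  exact ⟨(-1) ^ u, (-1) ^ v, neg_one_pow_eq_or ℤ u, neg_one_pow_eq_or ℤ v, by rw [← h]; ring⟩

lemma IsSol.swap {a b c r s : ℤ} {x y : ℕ} (h : IsSol a b c r s x y) :
    IsSol b a c s r y x := by
  obtain ⟨hx, hy, u, v, hu, hv, h⟩ := h
  exact ⟨hy, hx, v, u, hv, hu, by rw [← h]; ring⟩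

lemma IsSol.le_add {a b c r s : ℤ} (ha : 1 < a) (hb : 1 < b) (hr : 0 < r) (hs : 0 < s)
    {x y : ℕ} (h : IsSol a b c r s x y) : c ≤ r * a ^ x + s * b ^ y := by
  obtain ⟨e, f, he, hf, h⟩ := h.exists_signs
  have h1 : 0 < r * a ^ x := by positivity
  have h2 : 0 < s * b ^ y := by positivity
  rcases he with rfl | rfl <;> rcases hf with rfl | rfl <;> linarith

lemma sub_signed_pow (r a e f : ℤ) (he : e = 1 ∨ e = -1) (hf : f = 1 ∨ f = -1) (m n : ℕ) :
    ∃ σ : ℤ, (σ = 1 ∨ σ = -1) ∧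
      e * (r * a ^ m) - f * (r * a ^ n) = σ * (r * a ^ min m n * (a ^ gap m n - e * f)) := by
  have hee := sq_eq_one_of_sign he
  have hff := sq_eq_one_of_sign hf
  rcases le_total m n with h | h
  · obtain ⟨k, rfl⟩ := Nat.exists_eq_add_of_le h
    refine ⟨-f, by rcases hf with rfl | rfl <;> simp, ?_⟩
    simp only [gap, min_eq_left h, max_eq_right h, Nat.add_sub_cancel_left, pow_add]
    linear_combination (-e * r * a ^ m) * hff
  · obtain ⟨k, rfl⟩ := Nat.exists_eq_add_of_le h
    refine ⟨e, he, ?_⟩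
    simp only [gap, min_eq_right h, max_eq_left h, Nat.add_sub_cancel_left, pow_add]
    linear_combination (f * r * a ^ n) * hee

/-- Two solutions force `r * a ^ min x₁ x₂` to divide `b ^ |y₁ - y₂| ± 1`, with a cofactor prime
to `a` unless `x₁ = x₂`. -/
lemma IsSol.exists_pow_gap_eq {a b c r s : ℤ} (ha : 1 < a) (hr : 0 < r)
    (hco : IsCoprime (r * a) (s * b)) {x₁ y₁ x₂ y₂ : ℕ}
    (h₁ : IsSol a b c r s x₁ y₁) (h₂ : IsSol a b c r s x₂ y₂) :
    ∃ ε k : ℤ, (ε = 1 ∨ ε = -1) ∧ b ^ gap y₁ y₂ - ε = r * a ^ min x₁ x₂ * k ∧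
      ∃ ε', (ε' = 1 ∨ ε' = -1) ∧ ∃ σ, (σ = 1 ∨ σ = -1) ∧
        a ^ gap x₁ x₂ - ε' = σ * (s * b ^ min y₁ y₂ * k) := by
  obtain ⟨e₁, f₁, he₁, hf₁, E₁⟩ := h₁.exists_signs
  obtain ⟨e₂, f₂, he₂, hf₂, E₂⟩ := h₂.exists_signs
  obtain ⟨σ, hσ, H⟩ := sub_signed_pow r a e₁ e₂ he₁ he₂ x₁ x₂
  obtain ⟨τ, hτ, G⟩ := sub_signed_pow s b f₁ f₂ hf₁ hf₂ y₁ y₂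
  have sgn : ∀ {p q : ℤ}, (p = 1 ∨ p = -1) → (q = 1 ∨ q = -1) → (p * q = 1 ∨ p * q = -1) := by
    rintro p q (rfl | rfl) (rfl | rfl) <;> norm_num
  have hσσ := sq_eq_one_of_sign hσ
  have hττ := sq_eq_one_of_sign hτ
  have key : r * a ^ min x₁ x₂ * (a ^ gap x₁ x₂ - e₁ * e₂) =
      -(σ * τ) * (s * b ^ min y₁ y₂ * (b ^ gap y₁ y₂ - f₁ * f₂)) := by
    linear_combination σ * (E₁ - E₂) - σ * H - σ * G -
      (r * a ^ min x₁ x₂ * (a ^ gap x₁ x₂ - e₁ * e₂)) * hσσ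
  have hcop : IsCoprime (r * a ^ min x₁ x₂) (s * b ^ min y₁ y₂) := by
    have hrs := hco.of_mul_left_left
    have has := hco.of_mul_left_right
    exact IsCoprime.mul_left
      (IsCoprime.mul_right hrs.of_mul_right_left hrs.of_mul_right_right.pow_right)
      (IsCoprime.mul_right has.of_mul_right_left.pow_left has.of_mul_right_right.pow)
  have hστ := sq_eq_one_of_sign (sgn hσ hτ)
  have hdvd : r * a ^ min x₁ x₂ ∣ b ^ gap y₁ y₂ - f₁ * f₂ := by
    refine hcop.dvd_of_dvd_mul_left ⟨-(σ * τ) * (a ^ gap x₁ x₂ - e₁ * e₂), ?_⟩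
    linear_combination (σ * τ) * key -
      (s * b ^ min y₁ y₂ * (b ^ gap y₁ y₂ - f₁ * f₂)) * hστ
  obtain ⟨k, hk⟩ := hdvd
  refine ⟨f₁ * f₂, k, sgn hf₁ hf₂, hk, e₁ * e₂, sgn he₁ he₂, -(σ * τ), ?_, ?_⟩
  · rcases sgn hσ hτ with h | h <;> simp [h]
  · have hne : r * a ^ min x₁ x₂ ≠ 0 := by positivity
    apply mul_left_cancel₀ hne
    rw [key, hk]; ring

lemma isCoprime_of_pow_sub_sign {a k m σ ε : ℤ} {n : ℕ} (hn : n ≠ 0) (hε : ε = 1 ∨ ε = -1)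
    (h : a ^ n - ε = σ * (m * k)) : IsCoprime k a := by
  obtain ⟨n, rfl⟩ := Nat.exists_eq_succ_of_ne_zero hn
  have hee := sq_eq_one_of_sign hε
  exact ⟨-(ε * σ * m), ε * a ^ n, by rw [pow_succ] at h; linear_combination ε * h + hee⟩

lemma one_le_pow_sub_sign {b ε : ℤ} (hb : 1 < b) (hε : ε = 1 ∨ ε = -1) {n : ℕ} (hn : n ≠ 0) :
    1 ≤ b ^ n - ε ∧ b ^ n - ε ≤ b ^ n + 1 := by
  have : b ≤ b ^ n := le_self_pow₀ hb.le hn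
  rcases hε with rfl | rfl <;> constructor <;> linarith

lemma IsSol.le_pow_gap_add_one {a b c r s : ℤ} (ha : 1 < a) (hb : 1 < b) (hr : 0 < r)
    (hco : IsCoprime (r * a) (s * b)) {x₁ y₁ x₂ y₂ : ℕ}
    (h₁ : IsSol a b c r s x₁ y₁) (h₂ : IsSol a b c r s x₂ y₂) (hy : y₁ ≠ y₂) :
    r * a ^ min x₁ x₂ ≤ b ^ gap y₁ y₂ + 1 := by
  obtain ⟨ε, k, hε, hk, -⟩ := h₁.exists_pow_gap_eq ha hr hco h₂
  obtain ⟨hlo, hhi⟩ := one_le_pow_sub_sign hb hε (n := gap y₁ y₂) (by simp only [gap]; omega)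
  exact (Int.le_of_dvd (by omega) ⟨k, hk⟩).trans hhi

lemma IsSol.eq_two_of_fst_eq {a b c r s : ℤ} (ha : 1 < a) (hb : 1 < b) (hr : 0 < r) (hs : 0 < s)
    (hco : IsCoprime (r * a) (s * b)) {x y₁ y₂ : ℕ}
    (h₁ : IsSol a b c r s x y₁) (h₂ : IsSol a b c r s x y₂) (hy : y₁ < y₂) :
    b = 2 ∧ s * b ^ y₁ = 2 ∧ y₁ = 1 := by
  obtain ⟨ε, k, hε, hk, ε', hε', σ, hσ, h⟩ := h₁.exists_pow_gap_eq ha hr hco h₂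
  have hk0 : k ≠ 0 := by
    rintro rfl
    have := one_le_pow_sub_sign hb hε (n := gap y₁ y₂) (by simp only [gap]; omega)
    simp only [mul_zero] at hk
    omega
  have hy0 := h₁.2.1
  simp only [gap, min_self, max_self, Nat.sub_self, pow_zero, min_eq_left hy.le] at h
  have hsb : s * b ^ y₁ ∣ 2 := by
    rcases hε' with rfl | rfl
    · have : s * b ^ y₁ ≠ 0 := by positivity
      rcases hσ with rfl | rfl <;> simp_all
    · exact ⟨σ * k, by linear_combination h⟩
  have hb1 : b ≤ b ^ y₁ := le_self_pow₀ hb.le hy0.ne'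
  have h2 := Int.le_of_dvd two_pos hsb
  have h3 : b ^ y₁ ≤ s * b ^ y₁ := le_mul_of_one_le_left (by positivity) hs
  refine ⟨by omega, by omega, ?_⟩
  by_contra hne
  have : b ^ 2 ≤ b ^ y₁ := pow_le_pow_right₀ hb.le (by omega)
  nlinarith

lemma odd_prime_pow_dvd_exponent {p t : ℕ} (hp : p.Prime) (hp2 : p ≠ 2) {a b N k ε ε' : ℤ}
    {d D D' : ℕ} (hpN : (p : ℤ) ∣ N) (hN : N ≠ 0) (hpk : ¬ (p : ℤ) ∣ k) (hpb : ¬ (p : ℤ) ∣ b)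
    (hε : ε = 1 ∨ ε = -1) (hε' : ε' = 1 ∨ ε' = -1)
    (hD : b ^ D - ε = N * k) (hD' : N * a ^ d ∣ b ^ D' - ε') (ht : (p : ℤ) ^ t ∣ a ^ d) :
    (p : ℤ) ^ t ∣ D' := by
  have hpZ : Prime (p : ℤ) := Nat.prime_iff_prime_int.mp hp
  have hee := sq_eq_one_of_sign hε
  have hee' := sq_eq_one_of_sign hε'
  have hplus : ¬ (p : ℤ) ∣ b ^ D + ε := by
    intro h
    have h2 : (p : ℤ) ∣ 2 * b ^ D := by
      have := dvd_add h (hD ▸ hpN.mul_right k : (p : ℤ) ∣ b ^ D - ε)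
      rwa [show b ^ D + ε + (b ^ D - ε) = 2 * b ^ D by ring] at this
    rcases hpZ.dvd_or_dvd h2 with h | h
    · exact hp2 ((Nat.prime_dvd_prime_iff_eq hp Nat.prime_two).mp (by exact_mod_cast h))
    · exact hpb (hpZ.dvd_of_dvd_pow h)
  have hfac : b ^ (2 * D) - 1 = N * (k * (b ^ D + ε)) := by
    rw [mul_comm 2 D, pow_mul]
    linear_combination (b ^ D + ε) * hD + hee
  have hndvd : ¬ (p : ℤ) ∣ k * (b ^ D + ε) := fun h => (hpZ.dvd_or_dvd h).elim hpk hplus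
  have hlte := Int.emultiplicity_pow_sub_pow hp (hp.odd_of_ne_two hp2) (x := b ^ (2 * D)) (y := 1)
    (by rw [hfac]; exact hpN.mul_right _) (fun h => hpb (hpZ.dvd_of_dvd_pow h)) D'
  rw [one_pow, hfac, emultiplicity_mul hpZ, emultiplicity_eq_zero.mpr hndvd, add_zero] at hlte
  have hdvd : N * a ^ d ∣ (b ^ (2 * D)) ^ D' - 1 := by
    refine hD'.trans (Dvd.dvd.trans ⟨b ^ D' + ε', ?_⟩
      (sub_dvd_pow_sub_pow (b ^ (2 * D')) 1 D |>.trans ?_))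
    · rw [mul_comm 2 D', pow_mul]
      linear_combination hee'
    · rw [one_pow, ← pow_mul, ← pow_mul, show 2 * D' * D = 2 * D * D' by ring]
  have hle := emultiplicity_le_emultiplicity_of_dvd_right (a := (p : ℤ)) hdvd
  rw [hlte, emultiplicity_mul hpZ] at hle
  have hfin : emultiplicity (p : ℤ) N ≠ ⊤ := by
    rw [← finiteMultiplicity_iff_emultiplicity_ne_top]
    exact Int.finiteMultiplicity_iff.mpr ⟨by simpa using hp.ne_one, hN⟩
  have hle' := (ENat.add_le_add_iff_left hfin).mp hle
  have := (le_emultiplicity_of_pow_dvd ht).trans hle'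
  have h2 := pow_dvd_of_le_emultiplicity this
  exact_mod_cast h2

lemma two_pow_dvd_exponent_mul {t : ℕ} {b δ ε : ℤ} {D : ℕ} (hb : ¬ (2 : ℤ) ∣ b)
    (hδ : δ = 1 ∨ δ = -1) (hbδ : (4 : ℤ) ∣ b - δ) (hε : ε = 1 ∨ ε = -1)
    (ht : (2 : ℤ) ^ t ∣ b ^ D - ε) : (2 : ℤ) ^ t ∣ D * (b - δ) := by
  have hee := sq_eq_one_of_sign hε
  have h2 : Prime (2 : ℤ) := Int.prime_two
  have hlte := Int.two_pow_sub_pow (x := b) (y := 1) (n := 2 * D) (by omega) hb (even_two_mul D)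
  have hself : emultiplicity (2 : ℤ) 2 = 1 := by
    simpa using emultiplicity_pow_self_of_prime h2 1
  have hone : emultiplicity (2 : ℤ) (b + δ) = 1 := by
    apply emultiplicity_eq_of_dvd_of_not_dvd (k := 1) <;> rcases hδ with rfl | rfl <;> omega
  have hprod : emultiplicity (2 : ℤ) (b + 1) + emultiplicity (2 : ℤ) (b - 1) =
      1 + emultiplicity (2 : ℤ) (b - δ) := by
    rcases hδ with rfl | rfl
    · rw [hone]
    · rw [← sub_eq_add_neg] at hone
      rw [hone, sub_neg_eq_add, add_comm]
  have hfac : b ^ (2 * D) - 1 ^ (2 * D) = (b ^ D - ε) * (b ^ D + ε) := by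
    rw [mul_comm 2 D, pow_mul, one_pow]
    linear_combination hee
  have hodd : ¬ (2 : ℤ) ∣ b ^ D := fun h => hb (h2.dvd_of_dvd_pow h)
  have hplus : (1 : ℕ∞) ≤ emultiplicity (2 : ℤ) (b ^ D + ε) := by
    have : (2 : ℤ) ^ 1 ∣ b ^ D + ε := by
      rcases hε with rfl | rfl <;> omega
    exact_mod_cast le_emultiplicity_of_pow_dvd this
  rw [hfac, emultiplicity_mul h2, hprod, Nat.cast_mul, emultiplicity_mul h2] at hlte
  have ht' := le_emultiplicity_of_pow_dvd ht
  apply pow_dvd_of_le_emultiplicity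
  rw [emultiplicity_mul h2]
  have hcast : emultiplicity (2 : ℤ) ((2 : ℕ) : ℤ) = 1 := by exact_mod_cast hself
  rw [hcast] at hlte
  have hle : (2 : ℕ∞) + t ≤ 2 + (emultiplicity (2 : ℤ) D + emultiplicity (2 : ℤ) (b - δ)) := by
    calc (2 : ℕ∞) + t = t + 1 + 1 := by rw [add_comm, add_assoc, one_add_one_eq_two]
      _ ≤ _ := by gcongr
      _ = _ := hlte
      _ = _ := by rw [← one_add_one_eq_two]; ring
  exact (ENat.add_le_add_iff_left (by simp)).mp hle

lemma two_mul_pow_le {a : ℕ} {b N k ε ε' : ℤ} {d D D' : ℕ} (hb : 1 < b)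
    (hab : IsCoprime (a : ℤ) b) (haN : (a : ℤ) ∣ N) (hN : N ≠ 0) (hka : IsCoprime k a)
    (hε : ε = 1 ∨ ε = -1) (hε' : ε' = 1 ∨ ε' = -1) (hD'0 : D' ≠ 0)
    (hD : b ^ D - ε = N * k) (hD' : N * (a : ℤ) ^ d ∣ b ^ D' - ε') :
    2 * (a : ℤ) ^ d ≤ D' * (b + 1) := by
  have hD'pos : (0 : ℤ) < D' := by exact_mod_cast Nat.pos_of_ne_zero hD'0
  have hodd : ∀ p t : ℕ, p.Prime → p ≠ 2 → p ^ t ∣ a ^ d → (p : ℤ) ^ t ∣ D' := by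
    intro p t hp hp2 ht
    rcases Nat.eq_zero_or_pos t with rfl | htpos
    · simp
    have hpZ : Prime (p : ℤ) := Nat.prime_iff_prime_int.mp hp
    have hpa : (p : ℤ) ∣ a := by
      exact_mod_cast hp.dvd_of_dvd_pow ((dvd_pow_self p htpos.ne').trans ht)
    exact odd_prime_pow_dvd_exponent hp hp2 (hpa.trans haN) hN
      (fun h => hpZ.not_isUnit (hka.isUnit_of_dvd' h hpa))
      (fun h => hpZ.not_isUnit (hab.isUnit_of_dvd' hpa h)) hε hε' hD hD' (by exact_mod_cast ht)
  by_cases h2a : 2 ∣ a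
  · have h2aZ : (2 : ℤ) ∣ a := by exact_mod_cast h2a
    have h2b : ¬ (2 : ℤ) ∣ b := fun h => Int.prime_two.not_isUnit (hab.isUnit_of_dvd' h2aZ h)
    obtain ⟨δ, hδ, hbδ⟩ : ∃ δ : ℤ, (δ = 1 ∨ δ = -1) ∧ (4 : ℤ) ∣ b - δ := by
      rcases (by omega : b % 4 = 1 ∨ b % 4 = 3) with h | h
      · exact ⟨1, .inl rfl, by omega⟩
      · exact ⟨-1, .inr rfl, by omega⟩
    have hpos : 0 < b - δ := by rcases hδ with rfl | rfl <;> linarith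
    have hdvd : 2 * a ^ d ∣ D' * (b - δ).toNat := by
      rw [Nat.dvd_iff_prime_pow_dvd_dvd]
      intro p t hp ht
      have goalZ : (p : ℤ) ^ t ∣ D' * (b - δ) → p ^ t ∣ D' * (b - δ).toNat := by
        intro h
        rw [← Int.natCast_dvd_natCast]
        push_cast
        rwa [Int.toNat_of_nonneg hpos.le]
      apply goalZ
      by_cases hp2 : p = 2
      · subst hp2
        refine two_pow_dvd_exponent_mul h2b hδ hbδ hε' (Dvd.dvd.trans ?_ hD')
        calc ((2 : ℕ) : ℤ) ^ t ∣ 2 * (a : ℤ) ^ d := by exact_mod_cast ht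
          _ ∣ N * (a : ℤ) ^ d := mul_dvd_mul_right (h2aZ.trans haN) _
      · refine (hodd p t hp hp2 (Nat.Coprime.dvd_of_dvd_mul_left ?_ ht)).mul_right _
        exact Nat.Coprime.pow_left _ ((Nat.coprime_primes hp Nat.prime_two).mpr hp2)
    have hle : ((2 * a ^ d : ℕ) : ℤ) ≤ (D' * (b - δ).toNat : ℕ) := by
      exact_mod_cast Nat.le_of_dvd (Nat.mul_pos (Nat.pos_of_ne_zero hD'0) (by omega)) hdvd
    push_cast at hle
    rw [Int.toNat_of_nonneg hpos.le] at hle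
    have : b - δ ≤ b + 1 := by rcases hδ with rfl | rfl <;> linarith
    nlinarith
  · have hdvd : a ^ d ∣ D' := by
      rw [Nat.dvd_iff_prime_pow_dvd_dvd]
      intro p t hp ht
      by_cases hp2 : p = 2
      · subst hp2
        rcases Nat.eq_zero_or_pos t with rfl | htpos
        · simp
        · exact absurd (hp.dvd_of_dvd_pow ((dvd_pow_self 2 htpos.ne').trans ht)) h2a
      · exact_mod_cast hodd p t hp hp2 ht
    have hle : ((a : ℤ)) ^ d ≤ D' := by
      exact_mod_cast Nat.le_of_dvd (Nat.pos_of_ne_zero hD'0) hdvd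
    nlinarith

/-- The two smallest exponents of `a` among three solutions are close together. -/
lemma IsSol.two_mul_pow_le {a b c r s : ℤ} (ha : 1 < a) (hb : 1 < b) (hr : 0 < r)
    (hco : IsCoprime (r * a) (s * b)) {x₁ y₁ x₂ y₂ x₃ y₃ : ℕ}
    (h₁ : IsSol a b c r s x₁ y₁) (h₂ : IsSol a b c r s x₂ y₂) (h₃ : IsSol a b c r s x₃ y₃)
    (hx₁₂ : x₁ < x₂) (hx₂₃ : x₂ ≤ x₃) (hy : y₂ ≠ y₃) {Z J : ℤ} (hbJ : b ≤ J)
    (hy₂ : y₂ ≤ Z) (hy₃ : y₃ ≤ Z) :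
    2 * a ^ (x₂ - x₁) ≤ Z * (J + 1) := by
  lift a to ℕ using by omega
  obtain ⟨ε', k', hε', hk', -⟩ := h₂.exists_pow_gap_eq ha hr hco h₃
  obtain ⟨x, y, h, hx, -⟩ : ∃ x y, IsSol a b c r s x y ∧ x₁ < x ∧ y₁ ≠ y := by
    by_cases h : y₁ = y₂
    · exact ⟨x₃, y₃, h₃, by omega, by omega⟩
    · exact ⟨x₂, y₂, h₂, hx₁₂, h⟩
  obtain ⟨ε, k, hε, hk, ε'', hε'', σ, -, hσ⟩ := h₁.exists_pow_gap_eq ha hr hco h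
  rw [min_eq_left hx.le] at hk
  rw [min_eq_left hx₂₃] at hk'
  have key := _root_.two_mul_pow_le (d := x₂ - x₁) (D' := gap y₂ y₃) hb
    (hco.of_mul_left_right.of_mul_right_right) ((dvd_pow_self _ h₁.1.ne').mul_left r)
    (by positivity)
    (isCoprime_of_pow_sub_sign (n := gap x₁ x) (by simp only [gap]; omega) hε'' hσ) hε hε'
    (by simp only [gap]; omega) hk
    ⟨k', by rw [hk', mul_assoc r (_ ^ _) (_ ^ _), ← pow_add, Nat.add_sub_cancel' hx₁₂.le]⟩
  have hg : ((gap y₂ y₃ : ℕ) : ℤ) ≤ Z := by simp only [gap]; omega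
  refine key.trans (mul_le_mul hg (by omega) (by omega) (by omega))

lemma lt_sq_of_four_mul_le {c Z J V : ℤ} (hZ : 2 ≤ Z) (hJ : 3 ≤ J) (hV : V = Z * (J + 1))
    (h : 4 * c ≤ (V + 2) ^ 2) : c < (Z * J) ^ 2 := by
  have h1 : V + 2 < 2 * (Z * J) := by subst hV; nlinarith
  have h2 : 0 ≤ V := by subst hV; nlinarith
  nlinarith

lemma lt_sq_of_fst_eq {a b c r s : ℤ} (ha : 1 < a) (hb : 1 < b) (hr : 0 < r) (hs : 0 < s)
    (hco : IsCoprime (r * a) (s * b)) {x y₁ y₂ x₃ y₃ : ℕ}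
    (h₁ : IsSol a b c r s x y₁) (h₂ : IsSol a b c r s x y₂) (h₃ : IsSol a b c r s x₃ y₃)
    (hy : y₁ < y₂) (h₁₃ : (x, y₁) ≠ (x₃, y₃)) (h₂₃ : (x, y₂) ≠ (x₃, y₃))
    {Z J : ℤ} (haJ : a ≤ J) (hJ : 3 ≤ J)
    (hx : x ≤ Z) (hx₃ : x₃ ≤ Z) (hy₂ : y₂ ≤ Z) :
    c < (Z * J) ^ 2 := by
  obtain ⟨hb2, hB, hy1⟩ := h₁.eq_two_of_fst_eq ha hb hr hs hco h₂ hy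
  have hxx : x ≠ x₃ := by
    rintro rfl
    rcases lt_trichotomy y₂ y₃ with h | h | h
    · have := (h₂.eq_two_of_fst_eq ha hb hr hs hco h₃ h).2.2
      omega
    · exact h₂₃ (by rw [h])
    · have := (h₃.eq_two_of_fst_eq ha hb hr hs hco h₂ h).2.2
      exact h₁₃ (by rw [hy1, this])
  have hneq : ∀ y, IsSol a b c r s x y → y ≠ y₃ := by
    rintro y h rfl
    have ha2 : a = 2 := by
      rcases lt_or_gt_of_ne hxx with hlt | hlt
      · exact (h.swap.eq_two_of_fst_eq hb ha hs hr hco.symm h₃.swap hlt).1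
      · exact (h₃.swap.eq_two_of_fst_eq hb ha hs hr hco.symm h.swap hlt).1
    have := hco.of_mul_left_right.of_mul_right_right
    rw [ha2, hb2] at this
    exact Int.prime_two.not_isUnit (isCoprime_self.mp this)
  have hy₁₃ := hneq _ h₁
  have hy₂₃ := hneq _ h₂
  have hy₃pos := h₃.2.1
  have hZ : 2 ≤ Z := by omega
  have hV : 8 ≤ Z * (J + 1) := by nlinarith
  refine lt_sq_of_four_mul_le hZ hJ rfl ?_
  have hc₁ := h₁.le_add ha hb hr hs
  have hc₃ := h₃.le_add ha hb hr hs
  rcases lt_or_gt_of_ne hy₂₃ with hlt | hlt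
  · have hpow := IsSol.two_mul_pow_le hb ha hs hco.symm h₁.swap h₂.swap h₃.swap hy hlt.le hxx
      haJ hx hx₃
    have hA := h₁.le_pow_gap_add_one ha hb hr hco h₂ hy.ne
    simp only [gap, min_self, max_eq_right hy.le, min_eq_left hy.le] at hA
    nlinarith
  · have hlt' : y₁ < y₃ := by omega
    have hpow := IsSol.two_mul_pow_le hb ha hs hco.symm h₁.swap h₃.swap h₂.swap hlt' hlt.le
      hxx.symm haJ hx₃ hx
    have hA := h₁.le_pow_gap_add_one ha hb hr hco h₃ hlt'.ne
    simp only [gap, max_eq_right hlt'.le, min_eq_left hlt'.le] at hA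
    rcases le_total x x₃ with hle | hle
    · rw [min_eq_left hle] at hA
      nlinarith
    · rw [min_eq_right hle] at hA
      have hB₃ : s * b ^ y₃ = 2 * b ^ (y₃ - y₁) := by
        rw [← hB, mul_assoc, ← pow_add, Nat.add_sub_cancel' hlt'.le]
      nlinarith

lemma lt_sq_of_lt_of_lt {a b c r s : ℤ} (ha : 1 < a) (hb : 1 < b) (hr : 0 < r) (hs : 0 < s)
    (hco : IsCoprime (r * a) (s * b)) {x₁ y₁ x₂ y₂ x₃ y₃ : ℕ}
    (h₁ : IsSol a b c r s x₁ y₁) (h₂ : IsSol a b c r s x₂ y₂) (h₃ : IsSol a b c r s x₃ y₃)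
    (hx₁₂ : x₁ < x₂) (hx₂₃ : x₂ < x₃) (hy₁₂ : y₁ ≠ y₂) (hy₁₃ : y₁ ≠ y₃) (hy₂₃ : y₂ ≠ y₃)
    {Z J : ℤ} (haJ : a ≤ J) (hbJ : b ≤ J) (hJ : 3 ≤ J)
    (hx₁ : x₁ ≤ Z) (hx₂ : x₂ ≤ Z) (hx₃ : x₃ ≤ Z) (hy₂ : y₂ ≤ Z) (hy₃ : y₃ ≤ Z) :
    c < (Z * J) ^ 2 := by
  have hx₁₃ := hx₁₂.trans hx₂₃
  have hZ : 2 ≤ Z := by omega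
  have hV : 8 ≤ Z * (J + 1) := by nlinarith
  refine lt_sq_of_four_mul_le hZ hJ rfl ?_
  have hc₁ := h₁.le_add ha hb hr hs
  have hc₂ := h₂.le_add ha hb hr hs
  have hpa := h₁.two_mul_pow_le ha hb hr hco h₂ h₃ hx₁₂ hx₂₃.le hy₂₃ hbJ hy₂ hy₃
  have hB := h₁.swap.le_pow_gap_add_one hb ha hs hco.symm h₂.swap hx₁₂.ne
  have hA₁₂ := h₁.le_pow_gap_add_one ha hb hr hco h₂ hy₁₂
  have hA₁₃ := h₁.le_pow_gap_add_one ha hb hr hco h₃ hy₁₃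
  have hA₂₃ := h₂.le_pow_gap_add_one ha hb hr hco h₃ hy₂₃
  simp only [gap, min_eq_left hx₁₂.le, max_eq_right hx₁₂.le, min_eq_left hx₁₃.le,
    min_eq_left hx₂₃.le] at hB hA₁₂ hA₁₃ hA₂₃
  have pb : ∀ {x y x' y' x'' y'' : ℕ}, IsSol a b c r s x y → IsSol a b c r s x' y' →
      IsSol a b c r s x'' y'' → y < y' → y' < y'' → x' ≠ x'' → x' ≤ Z → x'' ≤ Z →
      2 * b ^ (y' - y) ≤ Z * (J + 1) := fun h h' h'' hlt hlt' hne hx' hx'' =>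
    h.swap.two_mul_pow_le hb ha hs hco.symm h'.swap h''.swap hlt hlt'.le hne haJ hx' hx''
  generalize Z * (J + 1) = V at *
  rcases lt_or_gt_of_ne hy₁₂ with h12 | h12
  · rw [min_eq_left h12.le] at hB
    rcases lt_or_gt_of_ne hy₁₃ with h13 | h13
    · -- `y₁` is the least, so `(x₁, y₁)` is smallest in both coordinates
      rcases lt_or_gt_of_ne hy₂₃ with h23 | h23
      · have := pb h₁ h₂ h₃ h12 h23 hx₂₃.ne hx₂ hx₃
        rw [max_eq_right h12.le, min_eq_left h12.le] at hA₁₂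
        nlinarith
      · have := pb h₁ h₃ h₂ h13 h23 hx₂₃.ne' hx₃ hx₂
        rw [max_eq_right h13.le, min_eq_left h13.le] at hA₁₃
        nlinarith
    · have := pb h₃ h₁ h₂ h13 h12 hx₁₂.ne hx₁ hx₂
      rw [max_eq_left h13.le, min_eq_right h13.le] at hA₁₃
      nlinarith
  · rw [min_eq_right h12.le] at hB
    rcases lt_or_gt_of_ne hy₂₃ with h23 | h23
    · rcases lt_or_gt_of_ne hy₁₃ with h13 | h13
      · have := pb h₂ h₁ h₃ h12 h13 hx₁₃.ne hx₁ hx₃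
        rw [max_eq_left h12.le, min_eq_right h12.le] at hA₁₂
        have hA₂ : r * a ^ x₂ = r * a ^ x₁ * a ^ (x₂ - x₁) := by
          rw [mul_assoc, ← pow_add, Nat.add_sub_cancel' hx₁₂.le]
        have hpos : 0 < a ^ (x₂ - x₁) := by positivity
        have hprod : (2 * (r * a ^ x₁)) * (2 * a ^ (x₂ - x₁)) ≤ (V + 2) * V :=
          mul_le_mul (by linarith) hpa (by positivity) (by linarith)
        nlinarith
      · have := pb h₂ h₃ h₁ h23 h13 hx₁₃.ne' hx₃ hx₁
        rw [max_eq_right h23.le, min_eq_left h23.le] at hA₂₃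
        nlinarith
    · have := pb h₃ h₂ h₁ h23 h12 hx₁₂.ne' hx₂ hx₁
      rw [max_eq_left h23.le, min_eq_right h23.le] at hA₂₃
      nlinarith

lemma lt_sq_of_fst_eq' {a b c r s : ℤ} (ha : 1 < a) (hb : 1 < b) (hr : 0 < r) (hs : 0 < s)
    (hco : IsCoprime (r * a) (s * b)) {x₁ y₁ x₂ y₂ x₃ y₃ : ℕ}
    (h₁ : IsSol a b c r s x₁ y₁) (h₂ : IsSol a b c r s x₂ y₂) (h₃ : IsSol a b c r s x₃ y₃)
    (hx : x₁ = x₂) (h₁₂ : (x₁, y₁) ≠ (x₂, y₂)) (h₁₃ : (x₁, y₁) ≠ (x₃, y₃))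
    (h₂₃ : (x₂, y₂) ≠ (x₃, y₃)) {Z J : ℤ} (haJ : a ≤ J) (hJ : 3 ≤ J)
    (hx₁ : x₁ ≤ Z) (hx₃ : x₃ ≤ Z) (hy₁ : y₁ ≤ Z) (hy₂ : y₂ ≤ Z) :
    c < (Z * J) ^ 2 := by
  subst hx
  have hy : y₁ ≠ y₂ := fun h => h₁₂ (by rw [h])
  rcases lt_or_gt_of_ne hy with hy | hy
  · exact lt_sq_of_fst_eq ha hb hr hs hco h₁ h₂ h₃ hy h₁₃ h₂₃ haJ hJ hx₁ hx₃ hy₂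
  · exact lt_sq_of_fst_eq ha hb hr hs hco h₂ h₁ h₃ hy h₂₃ h₁₃ haJ hJ hx₁ hx₃ hy₁

theorem stmt_5 (a b c r s : ℤ)
    (ha : 1 < a) (hb : 1 < b) (hc : 0 < c) (hr : 0 < r) (hs : 0 < s)
    (hgcd : Int.gcd (r * a) (s * b) = 1)
    (x₁ y₁ x₂ y₂ x₃ y₃ : ℕ)
    (h1 : IsSol a b c r s x₁ y₁) (h2 : IsSol a b c r s x₂ y₂)
    (h3 : IsSol a b c r s x₃ y₃)
    (h12 : (x₁, y₁) ≠ (x₂, y₂)) (h13 : (x₁, y₁) ≠ (x₃, y₃))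
    (h23 : (x₂, y₂) ≠ (x₃, y₃)) :
    c < ((max (max (max x₁ x₂) (max x₃ y₁)) (max y₂ y₃) : ℤ) * max a b) ^ 2 := by
  have hco : IsCoprime (r * a) (s * b) := Int.isCoprime_iff_gcd_eq_one.mpr hgcd
  have hab : ¬ (a = 2 ∧ b = 2) := by
    rintro ⟨rfl, rfl⟩
    exact Int.prime_two.not_isUnit (isCoprime_self.mp hco.of_mul_left_right.of_mul_right_right)
  have haJ : a ≤ max a b := le_max_left _ _
  have hbJ : b ≤ max a b := le_max_right _ _
  have hJ : 3 ≤ max a b := by omega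
  generalize max a b = J at *
  obtain ⟨Z, hZ⟩ : ∃ Z : ℤ, Z = max (max (max (x₁ : ℤ) x₂) (max x₃ y₁)) (max y₂ y₃) := ⟨_, rfl⟩
  rw [← hZ]
  have hx₁ : x₁ ≤ Z := by omega
  have hx₂ : x₂ ≤ Z := by omega
  have hx₃ : x₃ ≤ Z := by omega
  have hy₁ : y₁ ≤ Z := by omega
  have hy₂ : y₂ ≤ Z := by omega
  have hy₃ : y₃ ≤ Z := by omega
  have sw : ∀ {m n m' n' : ℕ}, (m, n) ≠ (m', n') → (n, m) ≠ (n', m') := fun h h' => h (by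
    rw [Prod.mk.injEq] at h' ⊢; exact h'.symm)
  by_cases ex₁₂ : x₁ = x₂
  · exact lt_sq_of_fst_eq' ha hb hr hs hco h1 h2 h3 ex₁₂ h12 h13 h23 haJ hJ hx₁ hx₃ hy₁ hy₂
  by_cases ex₁₃ : x₁ = x₃
  · exact lt_sq_of_fst_eq' ha hb hr hs hco h1 h3 h2 ex₁₃ h13 h12 h23.symm haJ hJ hx₁ hx₂ hy₁ hy₃
  by_cases ex₂₃ : x₂ = x₃
  · exact lt_sq_of_fst_eq' ha hb hr hs hco h2 h3 h1 ex₂₃ h23 h12.symm h13.symm haJ hJ hx₂ hx₁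
      hy₂ hy₃
  by_cases ey₁₂ : y₁ = y₂
  · exact lt_sq_of_fst_eq' hb ha hs hr hco.symm h1.swap h2.swap h3.swap ey₁₂ (sw h12) (sw h13)
      (sw h23) hbJ hJ hy₁ hy₃ hx₁ hx₂
  by_cases ey₁₃ : y₁ = y₃
  · exact lt_sq_of_fst_eq' hb ha hs hr hco.symm h1.swap h3.swap h2.swap ey₁₃ (sw h13) (sw h12)
      (sw h23).symm hbJ hJ hy₁ hy₂ hx₁ hx₃
  by_cases ey₂₃ : y₂ = y₃
  · exact lt_sq_of_fst_eq' hb ha hs hr hco.symm h2.swap h3.swap h1.swap ey₂₃ (sw h23)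
      (sw h12).symm (sw h13).symm hbJ hJ hy₂ hy₁ hx₂ hx₃
  have main := @lt_sq_of_lt_of_lt a b c r s ha hb hr hs hco
  rcases lt_or_gt_of_ne ex₁₂ with l₁₂ | l₁₂ <;> rcases lt_or_gt_of_ne ex₁₃ with l₁₃ | l₁₃ <;>
    rcases lt_or_gt_of_ne ex₂₃ with l₂₃ | l₂₃
  · exact main h1 h2 h3 l₁₂ l₂₃ ey₁₂ ey₁₃ ey₂₃ haJ hbJ hJ hx₁ hx₂ hx₃ hy₂ hy₃
  · exact main h1 h3 h2 l₁₃ l₂₃ ey₁₃ ey₁₂ (Ne.symm ey₂₃) haJ hbJ hJ hx₁ hx₃ hx₂ hy₃ hy₂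
  · omega
  · exact main h3 h1 h2 l₁₃ l₁₂ (Ne.symm ey₁₃) (Ne.symm ey₂₃) ey₁₂ haJ hbJ hJ hx₃ hx₁ hx₂ hy₁ hy₂
  · exact main h2 h1 h3 l₁₂ l₁₃ (Ne.symm ey₁₂) ey₂₃ ey₁₃ haJ hbJ hJ hx₂ hx₁ hx₃ hy₁ hy₃
  · omega
  · exact main h2 h3 h1 l₂₃ l₁₃ ey₂₃ (Ne.symm ey₁₂) (Ne.symm ey₁₃) haJ hbJ hJ hx₂ hx₃ hx₁ hy₃ hy₁
  · exact main h3 h2 h1 l₂₃ l₁₂ (Ne.symm ey₂₃) (Ne.symm ey₁₃) (Ne.symm ey₁₂) haJ hbJ hJ hx₃ hx₂ hx₁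
      hy₂ hy₁
end

section
/- For every pair of integers a>1, b>1 with gcd(a,b)=1 such that neither a nor b is a perfect power, there are infinitely many pairs of positive integers (x₁,y₁) with the following property: there are infinitely many quintuples (r,s,c,x₂,y₂) of positive integers with gcd(ra,sb) = gcd(r,a) = gcd(s,b) = 1 and (x₁,y₁) ≠ (x₂,y₂), such that both (x₁,y₁) and (x₂,y₂) give solutions (for suitable u,v ∈ {0,1}) of the equation (-1)^u·r·a^x + (-1)^v·s·b^y = c, and the equation has no further solution in positive integers x,y with u,v ∈ {0,1}. -/
/-- An integer `N > 1` is a perfect power if `N = t^k` with `t > 1` and `k > 1`. -/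
def IsPerfectPower (N : ℤ) : Prop :=
  ∃ (t : ℤ) (k : ℕ), 1 < t ∧ 1 < k ∧ t ^ k = N

theorem exists_prime_not_dvd_pow_add_pow {b M : ℕ} (hb : 1 < b) (hM : 0 < M)
    (hbM : b.Coprime M) :
    ∃ l : ℕ, l.Prime ∧ l.Coprime M ∧ l.Coprime b ∧ ∀ i j : ℕ, ¬ l ∣ b ^ i + b ^ j := by
  obtain ⟨c, rfl⟩ : ∃ c, b = c + 1 := ⟨b - 1, by omega⟩
  set t := M.totient with ht
  have htpos : 0 < t := Nat.totient_pos.2 hM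
  set q := 2 * (M * t) + 1 with hq
  set D := ∑ i ∈ Finset.range q, (c + 1) ^ i with hD
  have hqpos : 0 < M * t := Nat.mul_pos hM htpos
  have hgeom : D * c + 1 = (c + 1) ^ q := geom_sum_mul_add c q
  have hDgt : 1 < D := by
    have h1 : ∑ i ∈ Finset.range 2, (c + 1) ^ i ≤ D :=
      Finset.sum_le_sum_of_subset (Finset.range_mono (by omega))
    simp [Finset.sum_range_succ] at h1
    omega
  have hblock : ∀ k : ℕ, ∑ i ∈ Finset.range (t * k), (c + 1) ^ i ≡
      k * ∑ i ∈ Finset.range t, (c + 1) ^ i [MOD M] := by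
    intro k
    induction k with
    | zero => simp; rfl
    | succ k ih =>
      rw [Nat.mul_succ, Finset.sum_range_add, Nat.succ_mul]
      refine ih.add ?_
      have h1 : ((c + 1) ^ (t * k)) ≡ 1 [MOD M] := by
        have := (Nat.ModEq.pow_totient hbM).pow k
        rwa [← pow_mul, one_pow] at this
      simp_rw [pow_add]
      rw [← Finset.mul_sum]
      simpa using h1.mul_right (∑ i ∈ Finset.range t, (c + 1) ^ i)
  have hDM : D ≡ 1 [MOD M] := by
    have h1 := hblock (2 * M)
    have h2 : t * (2 * M) = 2 * (M * t) := by ring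
    rw [h2] at h1
    have h3 : 2 * M * ∑ i ∈ Finset.range t, (c + 1) ^ i ≡ 0 [MOD M] :=
      Nat.modEq_zero_iff_dvd.2 ⟨2 * ∑ i ∈ Finset.range t, (c + 1) ^ i, by ring⟩
    have h4 : ((c + 1) ^ (2 * (M * t))) ≡ 1 [MOD M] := by
      have := (Nat.ModEq.pow_totient hbM).pow (2 * M)
      rwa [← pow_mul, one_pow, h2] at this
    rw [hD, hq, Finset.sum_range_succ]
    simpa using (h1.trans h3).add h4
  have hDodd : Odd D := by
    rw [Nat.odd_iff]
    rcases Nat.even_or_odd c with hc | hc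
    · have h : ∀ i, (c + 1) ^ i ≡ 1 [MOD 2] := fun i => by
        have : (c + 1) ≡ 1 [MOD 2] := by
          rw [Nat.ModEq]; have := Nat.even_iff.1 hc; omega
        simpa using this.pow i
      rw [hD, Finset.sum_nat_mod, Finset.sum_congr rfl (fun i _ => h i)]
      simp
      omega
    · have h : Odd (D * c + 1 + 1) := by
        rw [hgeom]; exact Even.add_one (hc.add_one.pow_of_ne_zero (by omega))
      rcases Nat.even_or_odd D with hD' | hD'
      · have := hD'.mul_right c
        rw [Nat.even_iff] at this; rw [Nat.odd_iff] at h; omega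
      · exact Nat.odd_iff.1 hD'
  have hDcop : D.Coprime M := by
    rw [Nat.Coprime, hDM.gcd_eq]; simp
  have hDb : D.Coprime (c + 1) := by
    have h1 : (D * c + 1).Coprime D := by simp
    rw [hgeom] at h1
    exact ((Nat.coprime_pow_left_iff (by omega) _ _).1 h1).symm
  have hl : D.minFac.Prime := Nat.minFac_prime (by omega)
  have hlD : D.minFac ∣ D := Nat.minFac_dvd D
  refine ⟨D.minFac, hl, hDcop.coprime_dvd_left hlD, hDb.coprime_dvd_left hlD, ?_⟩
  set l := D.minFac with hldef
  intro i j hij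
  have hlodd : Odd l := hDodd.of_dvd_nat hlD
  have hqone : ((c + 1 : ℕ) : ZMod l) ^ q = 1 := by
    have h0 : (D : ZMod l) = 0 := (ZMod.natCast_eq_zero_iff _ _).2 hlD
    have := congrArg (Nat.cast : ℕ → ZMod l) hgeom
    push_cast at this ⊢
    rw [← this, h0]; ring
  have hs : ((c + 1 : ℕ) : ZMod l) ^ i = -((c + 1 : ℕ) : ZMod l) ^ j := by
    have := (ZMod.natCast_eq_zero_iff _ _).2 hij
    push_cast at this ⊢
    linear_combination this
  have hodd : Odd q := ⟨M * t, rfl⟩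
  have h2 : (1 : ZMod l) = -1 := by
    have := congrArg (· ^ q) hs
    simpa only [hodd.neg_pow, pow_right_comm _ _ q, hqone, one_pow] using this
  have h3 : l ∣ 2 := by
    rw [← ZMod.natCast_eq_zero_iff]
    push_cast
    linear_combination h2
  have := (Nat.prime_dvd_prime_iff_eq hl Nat.prime_two).1 h3
  rw [this] at hlodd
  exact absurd hlodd (by decide)

theorem exists_coprime_one_add_pow_of_dvd {a w n : ℕ} (ha : 0 < a) (hw : a ^ 2 ∣ w)
    (hn : n ∣ a) : ∃ e, (1 + w) ^ n = 1 + w * n * e ∧ e.Coprime a := by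
  obtain ⟨d, rfl⟩ := hn
  have hn : 0 < n := Nat.pos_of_mul_pos_right ha
  have hmod : ∑ i ∈ Finset.range n, (w + 1) ^ i ≡ n [MOD (n * d) ^ 2] := by
    have h : ∀ i, (w + 1) ^ i ≡ 1 [MOD (n * d) ^ 2] := fun i => by
      have : w + 1 ≡ 0 + 1 [MOD (n * d) ^ 2] := (Nat.modEq_zero_iff_dvd.2 hw).add_right 1
      simpa using this.pow i
    have := Nat.ModEq.sum (s := Finset.range n) (fun i _ => h i)
    simpa using this
  have hle : n ≤ ∑ i ∈ Finset.range n, (w + 1) ^ i := by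
    calc n = ∑ i ∈ Finset.range n, 1 := by simp
      _ ≤ _ := Finset.sum_le_sum fun i _ => Nat.one_le_pow _ _ (by omega)
  obtain ⟨z, hz⟩ := (Nat.modEq_iff_dvd' hle).1 hmod.symm
  refine ⟨1 + n * d * (d * z), ?_, by simp⟩
  have hsum : ∑ i ∈ Finset.range n, (w + 1) ^ i = n + (n * d) ^ 2 * z := by omega
  rw [add_comm 1 w, ← geom_sum_mul_add, hsum]
  ring

theorem exists_coprime_one_add_pow_of_dvd_pow {a w : ℕ} (ha : 0 < a) (hw : a ^ 2 ∣ w) (k : ℕ) :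
    ∀ n, n ∣ a ^ k → ∃ e, (1 + w) ^ n = 1 + w * n * e ∧ e.Coprime a := by
  induction k with
  | zero =>
    intro n hn
    obtain rfl : n = 1 := by simpa using hn
    exact ⟨1, by simp, by simp⟩
  | succ k ih =>
    intro n hn
    rw [pow_succ] at hn
    obtain ⟨n₁, n₂, h₁, h₂, rfl⟩ := exists_dvd_and_dvd_of_dvd_mul hn
    obtain ⟨e, he, hea⟩ := ih n₁ h₁
    obtain ⟨f, hf, hfa⟩ := exists_coprime_one_add_pow_of_dvd ha
      (w := w * n₁ * e) (hw.trans ⟨n₁ * e, by ring⟩) h₂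
    exact ⟨e * f, by rw [pow_mul, he, hf]; ring, hea.mul_left hfa⟩

theorem exists_coprime_one_add_pow {M w n : ℕ} (hw : M ∣ w) (hn : n.Coprime M) :
    ∃ e, (1 + w) ^ n = 1 + w * e ∧ e.Coprime M := by
  refine ⟨∑ i ∈ Finset.range n, (w + 1) ^ i, ?_, ?_⟩
  · rw [add_comm 1 w, ← geom_sum_mul_add]; ring
  · have h : ∀ i, (w + 1) ^ i ≡ 1 [MOD M] := fun i => by
      have : w + 1 ≡ 0 + 1 [MOD M] := (Nat.modEq_zero_iff_dvd.2 hw).add_right 1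
      simpa using this.pow i
    have := Nat.ModEq.sum (s := Finset.range n) (fun i _ => h i)
    rw [Nat.Coprime, this.gcd_eq]
    simpa using hn

theorem exists_eq_mul_dvd_pow_coprime (a : ℕ) {w : ℕ} (hw : 0 < w) :
    ∃ A z k : ℕ, w = A * z ∧ A ∣ a ^ k ∧ z.Coprime a := by
  induction w using Nat.strong_induction_on with
  | _ w ih =>
    by_cases h : w.Coprime a
    · exact ⟨1, w, 0, by simp, by simp, h⟩
    · have hd : 1 < w.gcd a := by
        have := Nat.gcd_pos_of_pos_left a hw
        rw [Nat.Coprime] at h; omega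
      obtain ⟨v, hv⟩ := Nat.gcd_dvd_left w a
      have hvpos : 0 < v := Nat.pos_of_ne_zero (by rintro rfl; omega)
      obtain ⟨A, z, k, h₁, h₂, h₃⟩ := ih v (by nlinarith) hvpos
      refine ⟨w.gcd a * A, z, k + 1, ?_, ?_, h₃⟩
      · rw [mul_assoc, ← h₁]; exact hv
      · rw [pow_succ, mul_comm]; exact mul_dvd_mul h₂ (Nat.gcd_dvd_right w a)

theorem exists_pow_eq_one_add_pow_mul_coprime {a b N : ℕ} (ha : 0 < a) (hN : 0 < N) (hb : 1 < b)
    (hab : b.Coprime (a * N)) :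
    ∃ k Y z : ℕ, 0 < k ∧ 0 < Y ∧ b ^ Y = 1 + a ^ k * z ∧ z.Coprime a ∧ a * N ∣ a ^ k * z := by
  have hcop : b.Coprime (a ^ 2 * N) :=
    (Nat.Coprime.pow_right 2 (hab.coprime_dvd_right ⟨N, rfl⟩)).mul_right
      (hab.coprime_dvd_right ⟨a, by ring⟩)
  set t := (a ^ 2 * N).totient with ht
  have htpos : 0 < t := Nat.totient_pos.2 (by positivity)
  have hone : 1 < b ^ t := Nat.one_lt_pow (by omega) hb
  have hdvd : a ^ 2 * N ∣ b ^ t - 1 :=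
    (Nat.modEq_iff_dvd' hone.le).1 (Nat.ModEq.pow_totient hcop).symm
  obtain ⟨w, hw⟩ : ∃ w, w = b ^ t - 1 := ⟨_, rfl⟩
  rw [← hw] at hdvd
  have hbw : b ^ t = 1 + w := by omega
  obtain ⟨A, z, k, rfl, hA, hz⟩ := exists_eq_mul_dvd_pow_coprime a (w := w) (by omega)
  obtain ⟨n, hn⟩ : A ∣ a ^ (k + 1) := hA.trans (pow_dvd_pow a (by omega))
  obtain ⟨e, he, hea⟩ := exists_coprime_one_add_pow_of_dvd_pow ha
    (Dvd.dvd.trans ⟨N, rfl⟩ hdvd) (k + 1) n ⟨A, by rw [hn]; ring⟩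
  have hnpos : 0 < n := by
    refine Nat.pos_of_ne_zero ?_
    rintro rfl
    exact (pow_pos ha (k + 1)).ne' (by simpa using hn)
  refine ⟨k + 1, t * n, z * e, by omega, by positivity, ?_, hz.mul_left hea, ?_⟩
  · rw [pow_mul, hbw, he, hn]; ring
  · refine (Dvd.dvd.trans (⟨a, by ring⟩ : a * N ∣ a ^ 2 * N) hdvd).trans ?_
    exact ⟨n * e, by rw [hn]; ring⟩

theorem prime_dvd_of_pow_dvd_pow_mul {a l k m g r z f : ℕ} (hl : l.Prime) (hla : l.Coprime a)
    (hlf : f.Coprime l) (hz : 0 < z) (hzm : z ≤ m) (hdvd : l ^ m ∣ a ^ k * (g * r))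
    (hg : g ∣ z * f) : l ∣ r := by
  by_contra h
  have h₁ : l ^ m ∣ g * r := (hla.pow m k).dvd_of_dvd_mul_left hdvd
  have h₂ : l ^ m ∣ g := (((Nat.Prime.coprime_iff_not_dvd hl).2 h).pow_left m).dvd_of_dvd_mul_right h₁
  have h₃ : l ^ m ∣ z := (hlf.symm.pow_left m).dvd_of_dvd_mul_right (h₂.trans hg)
  have h₄ := Nat.le_of_dvd hz h₃
  have h₅ := Nat.lt_pow_self hl.one_lt (n := m)
  omega

theorem mul_pow_ne_mul_pow_add {a b r s l i j α β X : ℕ} (hlr : l ∣ r) (hls : l.Coprime s)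
    (hl : ∀ i j : ℕ, ¬ l ∣ b ^ i + b ^ j) :
    r * a ^ i ≠ s * b ^ j + (r * a ^ (α + X) + s * b ^ β) := by
  intro h
  refine hl j β (hls.dvd_of_dvd_mul_left ?_)
  have h₁ : l ∣ s * (b ^ j + b ^ β) + r * a ^ (α + X) := by
    refine (hlr.mul_right (a ^ i)).trans (dvd_of_eq ?_)
    rw [h]; ring
  exact (Nat.dvd_add_left (hlr.mul_right _)).1 h₁

theorem eq_or_eq_of_mul_pow_add_mul_pow_eq {a b r s g i j α β X Y : ℕ} (ha : 1 < a) (hb : 1 < b)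
    (hr : 0 < r) (hs : 0 < s) (hg : 0 < g) (has : a.Coprime s)
    (hR : b ^ Y = 1 + a ^ α * (g * r)) (hS : a ^ X = 1 + b ^ β * (g * s))
    (hX : b ^ (β + Y + 1) < a ^ X) (hE : r * a ^ i + s * b ^ j = r * a ^ α + s * b ^ (β + Y)) :
    (i = α ∧ j = β + Y) ∨ (i = α + X ∧ j = β) := by
  have hE' : r * a ^ α + s * b ^ (β + Y) = r * a ^ (α + X) + s * b ^ β := by
    rw [pow_add, pow_add]
    refine Nat.eq_of_mul_eq_mul_left hg ?_
    calc g * (r * a ^ α + s * (b ^ β * b ^ Y))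
        = a ^ α * (g * r) + b ^ β * (g * s) * b ^ Y := by ring
      _ = g * (r * (a ^ α * a ^ X) + s * b ^ β) := by rw [hR, hS]; ring
  have hapos : ∀ n, 0 < a ^ n := fun n => pow_pos (by omega) n
  have hbpos : ∀ n, 0 < b ^ n := fun n => pow_pos (by omega) n
  rcases lt_trichotomy j (β + Y) with hj | hj | hj
  · rcases lt_trichotomy i (α + X) with hi | hi | hi
    · exfalso
      have hdvd : (a : ℤ) ^ i ∣ (b : ℤ) ^ j - (b : ℤ) ^ β := by
        have hc : IsCoprime ((a : ℤ) ^ i) (s : ℤ) := (Nat.isCoprime_iff_coprime.2 has).pow_left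
        refine hc.dvd_of_dvd_mul_left ?_
        have h : (s : ℤ) * ((b : ℤ) ^ j - (b : ℤ) ^ β) = r * ((a : ℤ) ^ (α + X) - (a : ℤ) ^ i) := by
          have := hE.trans hE'
          zify at this
          linear_combination this
        rw [h]
        exact ((pow_dvd_pow _ hi.le).sub dvd_rfl).mul_left _
      have hne : (b : ℤ) ^ j - (b : ℤ) ^ β ≠ 0 := by
        intro h0
        have h1 : b ^ j = b ^ β := by zify; linarith
        have h2 := hE.trans hE'
        rw [h1] at h2
        have h3 : a ^ i = a ^ (α + X) := Nat.eq_of_mul_eq_mul_left hr (by omega)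
        exact hi.ne (Nat.pow_right_injective ha h3)
      have hle : a ^ i ≤ b ^ (β + Y) := by
        have h1 := Int.le_of_dvd (abs_pos.2 hne) ((dvd_abs _ _).2 hdvd)
        have h2 : b ^ j ≤ b ^ (β + Y) := Nat.pow_le_pow_right (by omega) hj.le
        have h3 : b ^ β ≤ b ^ (β + Y) := Nat.pow_le_pow_right (by omega) (by omega)
        have h4 := hbpos j
        have h5 := hbpos β
        zify at h2 h3 h4 h5 ⊢
        refine h1.trans (abs_le.2 ⟨by linarith, by linarith⟩)
      have hgr : g * r < b ^ Y := by
        have := Nat.le_mul_of_pos_left (g * r) (hapos α)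
        omega
      have hbj : b * (g * s * b ^ j) ≤ (b ^ β * (g * s)) * b ^ Y := by
        have h1 : b ^ (j + 1) ≤ b ^ (β + Y) := Nat.pow_le_pow_right (by omega) hj
        calc b * (g * s * b ^ j) = g * s * b ^ (j + 1) := by ring
          _ ≤ g * s * b ^ (β + Y) := Nat.mul_le_mul_left _ h1
          _ = _ := by ring
      have hYb : b ≤ b ^ Y := by
        refine Nat.le_self_pow ?_ b
        rintro rfl
        have : 0 < a ^ α * (g * r) := by have := hapos α; positivity
        simp at hR; omega
      have hlow : a ^ X * b ^ Y ≤ b * (g * r * a ^ i) := by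
        have h1 : b * (g * r * a ^ i) + b * (g * s * b ^ j) =
            b * (a ^ α * (g * r) + b ^ β * (g * s) * b ^ Y) := by
          calc _ = b * g * (r * a ^ i + s * b ^ j) := by ring
            _ = _ := by rw [hE]; ring
        have h2 : b * (a ^ α * (g * r) + b ^ β * (g * s) * b ^ Y) + b = b * (a ^ X * b ^ Y) := by
          rw [hS, hR]; ring
        have h3 : b ^ β * (g * s) * b ^ Y + b ^ Y = a ^ X * b ^ Y := by rw [hS]; ring
        have h4 : 2 * (a ^ X * b ^ Y) ≤ b * (a ^ X * b ^ Y) := Nat.mul_le_mul_right _ hb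
        omega
      have hup : b * (g * r * a ^ i) ≤ b ^ (β + Y + 1) * b ^ Y := by
        calc b * (g * r * a ^ i) ≤ b * (b ^ Y * b ^ (β + Y)) := by gcongr
          _ = _ := by ring
      have := Nat.le_of_mul_le_mul_right (hlow.trans hup) (hbpos Y)
      omega
    · right
      refine ⟨hi, ?_⟩
      have h2 := hE.trans hE'
      rw [hi] at h2
      have h3 : b ^ j = b ^ β := Nat.eq_of_mul_eq_mul_left hs (by omega)
      exact Nat.pow_right_injective hb h3
    · exfalso
      have h1 : a ^ (α + X + 1) ≤ a ^ i := Nat.pow_le_pow_right (by omega) hi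
      have h2 : 2 * (r * a ^ (α + X)) ≤ r * a ^ i := by
        calc 2 * (r * a ^ (α + X)) ≤ a * (r * a ^ (α + X)) := Nat.mul_le_mul_right _ ha
          _ = r * a ^ (α + X + 1) := by ring
          _ ≤ _ := Nat.mul_le_mul_left _ h1
      have h3 : s * b ^ β < a ^ X := by
        have : s * b ^ β ≤ b ^ β * (g * s) := by
          calc s * b ^ β ≤ g * (s * b ^ β) := Nat.le_mul_of_pos_left _ hg
            _ = _ := by ring
        omega
      have h4 : a ^ X ≤ r * a ^ (α + X) := by
        calc a ^ X ≤ (r * a ^ α) * a ^ X :=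
              Nat.le_mul_of_pos_left _ (Nat.mul_pos hr (hapos α))
          _ = _ := by ring
      have h5 := hE.trans hE'
      have h6 := Nat.mul_pos hs (hbpos j)
      omega
  · left
    refine ⟨?_, hj⟩
    rw [hj] at hE
    have h3 : a ^ i = a ^ α := Nat.eq_of_mul_eq_mul_left hr (by omega)
    exact Nat.pow_right_injective ha h3
  · exfalso
    have h1 : b ^ (β + Y + 1) ≤ b ^ j := Nat.pow_le_pow_right (by omega) hj
    have h2 : 2 * (s * b ^ (β + Y)) ≤ s * b ^ j := by
      calc 2 * (s * b ^ (β + Y)) ≤ b * (s * b ^ (β + Y)) := Nat.mul_le_mul_right _ hb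
        _ = s * b ^ (β + Y + 1) := by ring
        _ ≤ _ := Nat.mul_le_mul_left _ h1
    have h3 : r * a ^ α < b ^ Y := by
      have : r * a ^ α ≤ a ^ α * (g * r) := by
        calc r * a ^ α ≤ g * (r * a ^ α) := Nat.le_mul_of_pos_left _ hg
          _ = _ := by ring
      omega
    have h4 : b ^ Y ≤ s * b ^ (β + Y) := by
      calc b ^ Y ≤ (s * b ^ β) * b ^ Y :=
            Nat.le_mul_of_pos_left _ (Nat.mul_pos hs (hbpos β))
        _ = _ := by ring
    have h6 := Nat.mul_pos hr (hapos i)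
    omega

theorem mul_pow_add_mul_pow_eq_swap {a b r s g α β X Y : ℕ} (hg : 0 < g)
    (hR : b ^ Y = 1 + a ^ α * (g * r)) (hS : a ^ X = 1 + b ^ β * (g * s)) :
    r * a ^ (α + X) + s * b ^ β = r * a ^ α + s * b ^ (β + Y) := by
  refine Nat.eq_of_mul_eq_mul_left hg ?_
  rw [pow_add, pow_add, hR, hS]
  ring

theorem eq_or_eq_of_isSol {a b r s g l l' α β X Y : ℕ} (ha : 1 < a) (hb : 1 < b)
    (hr : 0 < r) (hs : 0 < s) (hg : 0 < g) (has : a.Coprime s) (hrs : r.Coprime s)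
    (hlr : l ∣ r) (hls' : l' ∣ s)
    (hlb : ∀ i j : ℕ, ¬ l ∣ b ^ i + b ^ j) (hla' : ∀ i j : ℕ, ¬ l' ∣ a ^ i + a ^ j)
    (hR : b ^ Y = 1 + a ^ α * (g * r)) (hS : a ^ X = 1 + b ^ β * (g * s))
    (hX : b ^ (β + Y + 1) < a ^ X) {x y : ℕ}
    (h : IsSol a b ((r * a ^ α + s * b ^ (β + Y) : ℕ) : ℤ) r s x y) :
    (x = α ∧ y = β + Y) ∨ (x = α + X ∧ y = β) := by
  have hswap := mul_pow_add_mul_pow_eq_swap hg hR hS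
  have hx : 0 < r * a ^ x := by positivity
  have hy : 0 < s * b ^ y := by positivity
  obtain ⟨-, -, u, v, hu, hv, h⟩ := h
  interval_cases u <;> interval_cases v
  · refine eq_or_eq_of_mul_pow_add_mul_pow_eq ha hb hr hs hg has hR hS hX ?_
    zify
    push_cast at h
    linarith
  · refine absurd ?_ (mul_pow_ne_mul_pow_add (i := x) (j := y) (α := α) (β := β) (X := X) (a := a)
      hlr (hrs.coprime_dvd_left hlr) hlb)
    rw [hswap]
    zify
    push_cast at h
    linarith
  · refine absurd ?_ (mul_pow_ne_mul_pow_add (i := y) (j := x) (α := β) (β := α) (X := Y) (a := b)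
      hls' (hrs.symm.coprime_dvd_left hls') hla')
    zify
    push_cast at h
    linarith
  · exfalso
    zify at hx hy
    push_cast at h
    have : (0 : ℤ) ≤ r * a ^ α + s * b ^ (β + Y) := by positivity
    linarith

theorem pow_dvd_of_eq_one_add {b l Y w v m : ℕ} (hl : l ∣ w) (hw : b ^ Y = 1 + w)
    (hv : b ^ (Y * l ^ m) = 1 + v) : l ^ m ∣ v := by
  have h : ((l : ℕ) : ℤ) ∣ (1 + w : ℤ) - 1 := by simpa using Int.natCast_dvd_natCast.2 hl
  have h₁ := (pow_dvd_pow _ (Nat.le_succ m)).trans (dvd_sub_pow_of_dvd_sub h m)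
  rw [one_pow] at h₁
  rw [pow_mul, hw] at hv
  zify at hv
  rw [hv] at h₁
  rw [add_sub_cancel_left] at h₁
  exact_mod_cast h₁

theorem stmt_7 (a b : ℤ) (ha : 1 < a) (hb : 1 < b) (hab : Int.gcd a b = 1)
    (hpa : ¬IsPerfectPower a) (hpb : ¬IsPerfectPower b) :
    {p : ℕ × ℕ | 0 < p.1 ∧ 0 < p.2 ∧
      {q : ℤ × ℤ × ℤ × ℕ × ℕ |
        0 < q.1 ∧ 0 < q.2.1 ∧ 0 < q.2.2.1 ∧
        Int.gcd (q.1 * a) (q.2.1 * b) = 1 ∧ Int.gcd q.1 a = 1 ∧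
        Int.gcd q.2.1 b = 1 ∧ p ≠ (q.2.2.2.1, q.2.2.2.2) ∧
        IsSol a b q.2.2.1 q.1 q.2.1 p.1 p.2 ∧
        IsSol a b q.2.2.1 q.1 q.2.1 q.2.2.2.1 q.2.2.2.2 ∧
        ∀ x y : ℕ, IsSol a b q.2.2.1 q.1 q.2.1 x y →
          (x, y) = p ∨ (x, y) = (q.2.2.2.1, q.2.2.2.2)}.Infinite}.Infinite := by
  lift a to ℕ using by omega
  lift b to ℕ using by omega
  replace ha : 1 < a := by exact_mod_cast ha
  replace hb : 1 < b := by exact_mod_cast hb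
  replace hab : a.Coprime b := by simpa using hab
  obtain ⟨l, hl, hla, hlb, hlpow⟩ :=
    exists_prime_not_dvd_pow_add_pow hb (by omega : 0 < a) hab.symm
  obtain ⟨l', hl', hlM', hla', hlpow'⟩ := exists_prime_not_dvd_pow_add_pow ha
    (Nat.mul_pos (by omega : 0 < b) hl.pos) (hab.mul_right hla.symm)
  have hlb' : l'.Coprime b := hlM'.coprime_dvd_right ⟨l, rfl⟩
  have hll' : l'.Coprime l := hlM'.coprime_dvd_right ⟨b, by ring⟩
  have hlpos := hl.pos
  have hlpos' := hl'.pos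
  obtain ⟨α, Y₀, z, hα, hY₀, hbY₀, hza, hz⟩ :=
    exists_pow_eq_one_add_pow_mul_coprime (a := a) (N := l * l') (by omega) (by positivity) hb
      (hab.symm.mul_right (hlb.symm.mul_right hlb'.symm))
  obtain ⟨β, X₀, z', hβ, hX₀, haX₀, hzb', hz'⟩ :=
    exists_pow_eq_one_add_pow_mul_coprime (a := b) (N := l * l') (by omega) (by positivity) ha
      (hab.mul_right (hla.symm.mul_right hla'.symm))
  have hzpos : 0 < z := by
    refine Nat.pos_of_ne_zero ?_
    rintro rfl
    exact (Nat.one_lt_pow hY₀.ne' hb).ne' (by simpa using hbY₀)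
  have hzpos' : 0 < z' := by
    refine Nat.pos_of_ne_zero ?_
    rintro rfl
    exact (Nat.one_lt_pow hX₀.ne' ha).ne' (by simpa using haX₀)
  refine Set.Infinite.of_image Prod.snd (Set.infinite_of_forall_exists_gt fun m₀ => ?_)
  obtain ⟨m, hm⟩ : ∃ m, m = m₀ + z' := ⟨_, rfl⟩
  have hmlt := Nat.lt_pow_self hl.one_lt (n := m)
  obtain ⟨Y, hY⟩ : ∃ Y, Y = Y₀ * l ^ m := ⟨_, rfl⟩
  have hmY : m < Y := hmlt.trans_le (by rw [hY]; exact Nat.le_mul_of_pos_left _ hY₀)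
  refine ⟨β + Y, ⟨(α, β + Y), ⟨hα, by positivity, ?_⟩, rfl⟩, by omega⟩
  refine Set.Infinite.of_image (fun q => q.2.2.2.1) (Set.infinite_of_forall_exists_gt fun n₀ => ?_)
  obtain ⟨n, hn⟩ : ∃ n, n = n₀ + z + b ^ (β + Y + 1) := ⟨_, rfl⟩
  have hnlt := Nat.lt_pow_self hl'.one_lt (n := n)
  obtain ⟨X, hX⟩ : ∃ X, X = X₀ * l' ^ n := ⟨_, rfl⟩
  have hnX : n < X := hnlt.trans_le (by rw [hX]; exact Nat.le_mul_of_pos_left _ hX₀)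
  have hXlt := Nat.lt_pow_self ha (n := X)
  obtain ⟨e, he, hea⟩ := exists_coprime_one_add_pow (M := a * l') (n := l ^ m)
    (Dvd.dvd.trans ⟨l, by ring⟩ hz) ((hla.mul_right hll'.symm).pow_left m)
  obtain ⟨f, hf, hfb⟩ := exists_coprime_one_add_pow (M := b * l) (n := l' ^ n)
    (Dvd.dvd.trans ⟨l', by ring⟩ hz') ((hlb'.mul_right hll').pow_left n)
  rw [← hbY₀, ← pow_mul, ← hY, mul_assoc] at he
  rw [← haX₀, ← pow_mul, ← hX, mul_assoc] at hf
  have hdvd : l ^ m ∣ a ^ α * (z * e) :=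
    pow_dvd_of_eq_one_add (Dvd.dvd.trans ⟨a * l', by ring⟩ hz) hbY₀ (hY ▸ he)
  have hdvd' : l' ^ n ∣ b ^ β * (z' * f) :=
    pow_dvd_of_eq_one_add (Dvd.dvd.trans ⟨b * l, by ring⟩ hz') haX₀ (hX ▸ hf)
  have hRcop : (z * e).Coprime a := hza.mul_left (hea.coprime_dvd_right ⟨l', rfl⟩)
  have hScop : (z' * f).Coprime b := hzb'.mul_left (hfb.coprime_dvd_right ⟨l, rfl⟩)
  have hRpos : 0 < z * e := by
    refine Nat.pos_of_ne_zero fun h => ?_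
    rw [h] at he
    exact (Nat.one_lt_pow (by omega : Y ≠ 0) hb).ne' (by simpa using he)
  have hgpos : 0 < (z * e).gcd (z' * f) := Nat.gcd_pos_of_pos_left _ hRpos
  have hSpos : 0 < z' * f := by
    refine Nat.pos_of_ne_zero fun h => ?_
    rw [h] at hf
    exact (Nat.one_lt_pow (by omega : X ≠ 0) ha).ne' (by simpa using hf)
  obtain ⟨g, r, s, hg, hrs, hr, hs⟩ : ∃ g r s : ℕ, 0 < g ∧ r.Coprime s ∧
      z * e = g * r ∧ z' * f = g * s := by
    obtain ⟨r, s, hrs, hr, hs⟩ := Nat.exists_coprime (z * e) (z' * f)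
    exact ⟨_, r, s, hgpos, hrs, hr.trans (mul_comm _ _), hs.trans (mul_comm _ _)⟩
  have hlr : l ∣ r := prime_dvd_of_pow_dvd_pow_mul hl hla
    (hfb.coprime_dvd_right ⟨b, by ring⟩) hzpos' (by omega) (hr ▸ hdvd) ⟨s, hs⟩
  have hls' : l' ∣ s := prime_dvd_of_pow_dvd_pow_mul hl' hlb'
    (hea.coprime_dvd_right ⟨a, by ring⟩) hzpos (by omega) (hs ▸ hdvd') ⟨r, hr⟩
  rw [hr] at he hRcop hRpos
  rw [hs] at hf hScop hSpos
  have hrpos : 0 < r := Nat.pos_of_mul_pos_left hRpos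
  have hspos : 0 < s := Nat.pos_of_mul_pos_left hSpos
  have hra : r.Coprime a := hRcop.coprime_dvd_left ⟨g, by ring⟩
  have hsb : s.Coprime b := hScop.coprime_dvd_left ⟨g, by ring⟩
  have hrb : r.Coprime b := by
    have h : (b ^ Y).Coprime r := by
      rw [he, show a ^ α * (g * r) = a ^ α * g * r by ring]; simp
    exact ((Nat.coprime_pow_left_iff (by omega) _ _).1 h).symm
  have hsa : a.Coprime s := by
    have h : (a ^ X).Coprime s := by
      rw [hf, show b ^ β * (g * s) = b ^ β * g * s by ring]; simp
    exact (Nat.coprime_pow_left_iff (by omega) _ _).1 h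
  refine ⟨α + X, ⟨((r : ℤ), (s : ℤ), ((r * a ^ α + s * b ^ (β + Y) : ℕ) : ℤ), α + X, β),
    ⟨?_, ?_, ?_, ?_, ?_, ?_, ?_, ?_, ?_, ?_⟩, rfl⟩, by omega⟩
  · exact Int.natCast_pos.2 hrpos
  · exact Int.natCast_pos.2 hspos
  · have : 0 < r * a ^ α + s * b ^ (β + Y) := by positivity
    exact Int.natCast_pos.2 this
  · have : (r * a).Coprime (s * b) := (hrs.mul_left hsa).mul_right (hrb.mul_left hab)
    exact_mod_cast this
  · simpa using hra
  · simpa using hsb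
  · simp only [ne_eq, Prod.mk.injEq, not_and]
    intro h
    omega
  · exact ⟨hα, by positivity, 0, 0, by simp, by simp, by push_cast; ring⟩
  · refine ⟨by positivity, hβ, 0, 0, by simp, by simp, ?_⟩
    rw [← mul_pow_add_mul_pow_eq_swap hg he hf]
    push_cast
    ring
  · intro x y h
    simpa using eq_or_eq_of_isSol ha hb hrpos hspos hg hsa hrs hlr hls' hlpow hlpow' he hf
      (by omega) h
end

section
/- Let a>1, b>1, c>0, r>0, s>0 be integers (with no coprimality restriction). Then the equation r·a^x − s·b^y = c has at most three solutions (x,y) in nonnegative integers x, y. -/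
section

open Finset

theorem choose_mul_one_add_pow_eq_sum {z J : ℕ} (k : ℕ) (d : ℤ) (hJ : z < J) :
    (z.choose k : ℤ) * (1 + d) ^ z =
      ∑ j ∈ range J, (z.choose j : ℤ) * ((j.choose k : ℤ) * (1 + d) ^ k * d ^ (j - k)) := by
  have hsub : ∑ j ∈ range J, (z.choose j : ℤ) * ((j.choose k : ℤ) * (1 + d) ^ k * d ^ (j - k)) =
      ∑ j ∈ range (z + 1), (z.choose j : ℤ) * ((j.choose k : ℤ) * (1 + d) ^ k * d ^ (j - k)) := by
    symm
    apply sum_subset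
    · intro j hj
      simp only [mem_range] at *
      omega
    · intro j _ hj
      rw [Nat.choose_eq_zero_of_lt (by simpa using hj : z < j)]
      simp
  rw [hsub]
  rcases lt_or_ge z k with h | h
  · rw [Nat.choose_eq_zero_of_lt h]
    simp only [Nat.cast_zero, zero_mul]
    symm
    apply sum_eq_zero
    intro j hj
    rw [Nat.choose_eq_zero_of_lt (by simp at hj; omega : j < k)]
    simp
  · obtain ⟨w, rfl⟩ := Nat.exists_eq_add_of_le h
    rw [add_assoc, sum_range_add, sum_eq_zero, zero_add, pow_add, add_comm 1 d, add_pow d 1 w,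
      mul_sum, mul_sum]
    · apply sum_congr rfl
      intro j _
      have hc := @Nat.choose_mul (k + w) (k + j) k (by omega)
      simp only [Nat.add_sub_cancel_left] at hc
      have hc' : ((k + w).choose (k + j) : ℤ) * ((k + j).choose k) =
        (k + w).choose k * w.choose j := by exact_mod_cast hc
      simp only [Nat.add_sub_cancel_left, one_pow, mul_one]
      linear_combination (-(d + 1) ^ k * d ^ j) * hc'
    · intro j hj
      rw [Nat.choose_eq_zero_of_lt (by simpa using hj : j < k)]
      simp

theorem sum_range_card_le_sum {ι : Type*} [Fintype ι] (f : ι → ℕ) (hf : Function.Injective f) :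
    ∑ i ∈ range (Fintype.card ι), i ≤ ∑ i, f i := by
  have h := Finset.sum_range_le_sum (s := univ.image fun i => (f i : ℤ)) (c := 0) (by simp)
  rw [card_image_of_injective _ (fun a b hab => hf (by exact_mod_cast hab)),
    sum_image (fun a _ b _ hab => hf (by exact_mod_cast hab))] at h
  simp only [zero_add, card_univ] at h
  zify
  exact h

theorem pow_dvd_det_choose_mul_pow {ι : Type*} [Fintype ι] [DecidableEq ι] (z k l : ι → ℕ)
    {y θ : ℤ} (hθ : y ∣ θ - 1) {G : ℕ}
    (hG : G + ∑ i, k i ≤ ∑ i ∈ range (Fintype.card ι), i) :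
    y ^ G ∣ (Matrix.of fun i c => ((z i).choose (k c) : ℤ) * θ ^ (l c * z i)).det := by
  set J := ∑ i, z i + 1 with hJ
  have hzJ : ∀ i, z i < J := fun i =>
    Nat.lt_succ_of_le (single_le_sum (f := z) (fun _ _ => Nat.zero_le _) (mem_univ i))
  let d : ι → ℤ := fun c => θ ^ l c - 1
  let C : ι → Fin J → ℤ := fun c j =>
    (((j : ℕ).choose (k c) : ℤ) * (1 + d c) ^ k c * d c ^ ((j : ℕ) - k c))
  have hd : ∀ c, y ∣ d c := fun c => hθ.trans (by simpa using sub_dvd_pow_sub_pow θ 1 (l c))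
  have hmat : (Matrix.of fun i c => ((z i).choose (k c) : ℤ) * θ ^ (l c * z i)).transpose =
      fun c => ∑ j : Fin J, C c j • fun i => ((z i).choose (j : ℕ) : ℤ) := by
    ext c i
    simp only [Matrix.transpose_apply, Matrix.of_apply, Finset.sum_apply, Pi.smul_apply,
      smul_eq_mul]
    rw [pow_mul, show θ ^ l c = 1 + d c by simp [d],
      choose_mul_one_add_pow_eq_sum (k c) (d c) (hzJ i), sum_range]
    exact sum_congr rfl fun j _ => mul_comm _ _
  rw [← Matrix.det_transpose, hmat]
  change y ^ G ∣ (Matrix.detRowAlternating (R := ℤ) (n := ι)).toMultilinearMap _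
  rw [MultilinearMap.map_sum]
  apply dvd_sum
  intro r _
  rw [MultilinearMap.map_smul_univ]
  by_cases hr : Function.Injective r
  · apply Dvd.dvd.mul_right
    have hle : G ≤ ∑ c, ((r c : ℕ) - k c) := by
      have h1 := sum_range_card_le_sum (fun c => (r c : ℕ)) (Fin.val_injective.comp hr)
      have h2 : ∑ c, (r c : ℕ) ≤ ∑ c, ((r c : ℕ) - k c) + ∑ c, k c := by
        rw [← sum_add_distrib]
        exact sum_le_sum fun c _ => by omega
      omega
    refine (pow_dvd_pow y hle).trans ?_
    rw [← prod_pow_eq_pow_sum]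
    exact prod_dvd_prod_of_dvd _ _ fun c _ => Dvd.dvd.mul_left (pow_dvd_pow_of_dvd (hd c) _) _
  · have hz : (Matrix.detRowAlternating (R := ℤ) (n := ι)).toMultilinearMap
        (fun c i => ((z i).choose (r c : ℕ) : ℤ)) = 0 := by
      simp only [Function.Injective, not_forall] at hr
      obtain ⟨c₁, c₂, h, hne⟩ := hr
      exact Matrix.det_zero_of_row_eq hne (by rw [h])
    rw [hz, smul_zero]
    exact dvd_zero _

theorem abs_det_le_factorial_mul_prod {ι : Type*} [Fintype ι] [DecidableEq ι]
    (A : Matrix ι ι ℤ) (B : ι → ℤ) (h : ∀ i c, |A i c| ≤ B c) :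
    |A.det| ≤ (Fintype.card ι).factorial * ∏ c, B c := by
  rw [Matrix.det_apply]
  refine (abs_sum_le_sum_abs _ _).trans ?_
  calc ∑ σ : Equiv.Perm ι, |Equiv.Perm.sign σ • ∏ i, A (σ i) i|
      ≤ ∑ _σ : Equiv.Perm ι, ∏ c, B c := by
        apply sum_le_sum
        intro σ _
        rw [Units.smul_def, smul_eq_mul, abs_mul, ← Int.cast_id (n := (Equiv.Perm.sign σ : ℤ)),
          abs_unit_intCast, one_mul, abs_prod]
        exact prod_le_prod (fun _ _ => abs_nonneg _) fun i _ => h _ _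
    _ = _ := by simp [Fintype.card_perm]
open Polynomial in
theorem natDegree_prod_le_and_coeff {ι : Type*} (s : Finset ι) (f : ι → ℚ[X]) (d : ι → ℕ)
    (h : ∀ i ∈ s, (f i).natDegree ≤ d i) :
    (∏ i ∈ s, f i).coeff (∑ i ∈ s, d i) = ∏ i ∈ s, (f i).coeff (d i) := by
  classical
  induction s using Finset.induction_on with
  | empty => simp
  | insert a s ha ih =>
    rw [prod_insert ha, sum_insert ha, prod_insert ha, coeff_mul_add_eq_of_natDegree_le
      (h a (mem_insert_self _ _)) ((natDegree_prod_le _ _).trans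
        (sum_le_sum fun i hi => h i (mem_insert_of_mem hi))),
      ih fun i hi => h i (mem_insert_of_mem hi)]

open Polynomial in
theorem natDegree_det_le_sum {n : Type*} [Fintype n] [DecidableEq n] (A : Matrix n n ℚ[X])
    (d : n → ℕ) (h : ∀ i j, (A i j).natDegree ≤ d j) : A.det.natDegree ≤ ∑ j, d j := by
  rw [Matrix.det_apply]
  refine natDegree_sum_le_of_forall_le _ _ fun σ _ => ?_
  refine (natDegree_smul_le _ _).trans ((natDegree_prod_le _ _).trans ?_)
  exact sum_le_sum fun i _ => h _ _

open Polynomial in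
theorem coeff_det_sum {n : Type*} [Fintype n] [DecidableEq n] (A : Matrix n n ℚ[X])
    (d : n → ℕ) (h : ∀ i j, (A i j).natDegree ≤ d j) :
    A.det.coeff (∑ j, d j) = (Matrix.of fun i j => (A i j).coeff (d j)).det := by
  rw [Matrix.det_apply, Matrix.det_apply, finsetSum_coeff]
  refine sum_congr rfl fun σ _ => ?_
  rw [Units.smul_def, Units.smul_def, coeff_smul,
    natDegree_prod_le_and_coeff _ _ _ fun i _ => h _ _]
  rfl

open Polynomial in
/-- Zero estimate: polynomials `Q l` of degree less than `K` with `∑ l, Q l (z) w ^ l = 0` at all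
points `(z, w) = (v + u * q, x ^ v * β ^ u)` of a large enough box vanish identically. -/
theorem eq_zero_of_sum_eval_mul_pow_eq_zero {K L S T q : ℕ} (x β : ℚ) (hx : 1 < x) (hβ : 0 < β)
    (hK : 0 < K) (hST : L * K ≤ S * T) (hSq : S ≤ q) (Q : Fin L → ℚ[X])
    (hQ : ∀ l, (Q l).natDegree < K)
    (h : ∀ u < T, ∀ v < S + L,
      ∑ l, (Q l).eval ((v + u * q : ℕ) : ℚ) * (x ^ v * β ^ u) ^ (l : ℕ) = 0) : Q = 0 := by
  classical
  by_contra hne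
  let Λ := {l : Fin L // Q l ≠ 0}
  let t := Fintype.card Λ
  let e : Λ ≃ Fin t := Fintype.equivFin Λ
  have ht : t ≤ L := (Fintype.card_subtype_le _).trans (by simp)
  have ht0 : Nonempty (Fin t) := by
    obtain ⟨l, hl⟩ := Function.ne_iff.mp hne
    exact ⟨e ⟨l, hl⟩⟩
  let A : Matrix (Fin t) (Fin t) ℚ[X] := Matrix.of fun i j =>
    C ((x ^ ((e.symm j).1 : ℕ)) ^ (i : ℕ)) * taylor (i : ℚ) (Q (e.symm j).1)
  let d : Fin t → ℕ := fun j => (Q (e.symm j).1).natDegree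
  have hA : ∀ i j, (A i j).natDegree ≤ d j := fun i j =>
    (natDegree_C_mul_le _ _).trans (natDegree_taylor _ _).le
  have hcoeff : A.det.coeff (∑ j, d j) ≠ 0 := by
    rw [coeff_det_sum A d hA]
    have : (Matrix.of fun i j => (A i j).coeff (d j)) =
        Matrix.of fun i j => (Q (e.symm j).1).leadingCoeff *
          (Matrix.vandermonde fun j => x ^ ((e.symm j).1 : ℕ)).transpose i j := by
      ext i j
      simp only [A, d, Matrix.of_apply, coeff_C_mul, Matrix.transpose_apply,
        Matrix.vandermonde_apply]
      rw [mul_comm]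
      congr 1
      have := leadingCoeff_taylor (i : ℚ) (Q (e.symm j).1)
      rwa [leadingCoeff, natDegree_taylor] at this
    rw [this, Matrix.det_mul_row, Matrix.det_transpose]
    refine mul_ne_zero (prod_ne_zero_iff.mpr fun j _ => ?_) ?_
    · exact leadingCoeff_ne_zero.mpr (e.symm j).2
    · rw [Matrix.det_vandermonde_ne_zero_iff]
      intro i j hij
      exact e.symm.injective (Subtype.ext (Fin.ext (pow_right_injective₀ (by linarith)
        (by linarith) hij)))
  have hdet : A.det ≠ 0 := fun h0 => hcoeff (by rw [h0, coeff_zero])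
  let Z : Finset ℚ := (range S ×ˢ range T).image fun p => ((p.1 + p.2 * q : ℕ) : ℚ)
  have hZcard : Z.card = S * T := by
    rw [card_image_of_injOn, card_product, card_range, card_range]
    rintro ⟨v, u⟩ h1 ⟨v', u'⟩ h2 heq
    simp only [coe_product, coe_range, Set.mem_prod, Set.mem_Iio] at h1 h2
    dsimp only at heq
    have heq' : v + u * q = v' + u' * q := by exact_mod_cast heq
    have hq : 0 < q := by omega
    have hv : v = v' := by
      have := congrArg (· % q) heq'
      simpa [Nat.mod_eq_of_lt (h1.1.trans_le hSq), Nat.mod_eq_of_lt (h2.1.trans_le hSq)] using this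
    subst hv
    have : u = u' := Nat.eq_of_mul_eq_mul_right hq (by omega)
    rw [this]
  have hroot : Z ⊆ A.det.roots.toFinset := by
    intro z hz
    obtain ⟨⟨v, u⟩, hvu, rfl⟩ := mem_image.mp hz
    simp only [mem_product, mem_range] at hvu
    rw [Multiset.mem_toFinset, mem_roots hdet, IsRoot, ← coe_evalRingHom, RingHom.map_det,
      ← Matrix.exists_mulVec_eq_zero_iff]
    have hw : x ^ v * β ^ u ≠ 0 := by positivity
    refine ⟨fun j => (x ^ v * β ^ u) ^ ((e.symm j).1 : ℕ), fun h0 => ?_, ?_⟩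
    · exact pow_ne_zero _ hw (congrFun h0 ht0.some)
    · ext i
      have hi := h u hvu.2 (v + i) (by have := i.2; omega)
      have hsub : ∑ l : Λ, (Q l.1).eval ((v + i + u * q : ℕ) : ℚ) *
          (x ^ (v + (i : ℕ)) * β ^ u) ^ (l.1 : ℕ) = 0 := by
        rw [← hi, ← Finset.sum_subtype (univ.filter fun l => Q l ≠ 0) (by simp)
          fun l : Fin L => (Q l).eval ((v + i + u * q : ℕ) : ℚ) *
            (x ^ (v + (i : ℕ)) * β ^ u) ^ (l : ℕ)]
        refine sum_filter_of_ne fun l _ hl h0 => hl ?_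
        rw [h0, eval_zero, zero_mul]
      rw [Pi.zero_apply, ← hsub, ← e.symm.sum_comp]
      simp only [Matrix.mulVec, dotProduct, RingHom.mapMatrix_apply, Matrix.map_apply, A,
        Matrix.of_apply, coe_evalRingHom, eval_mul, eval_C, taylor_eval]
      refine sum_congr rfl fun j _ => ?_
      have h1 : ((v + u * q : ℕ) : ℚ) + ((i : ℕ) : ℚ) = ((v + i + u * q : ℕ) : ℚ) := by
        push_cast; ring
      rw [h1]
      ring
  have h1 := card_le_card hroot
  have h2 := (Multiset.toFinset_card_le A.det.roots).trans (card_roots' _)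
  have h3 := natDegree_det_le_sum A d hA
  have h4 : ∑ j, d j ≤ t * (K - 1) := by
    have := sum_le_card_nsmul univ d (K - 1) fun j _ => Nat.le_sub_one_of_lt (hQ _)
    simpa using this
  have h5 : t * (K - 1) ≤ L * (K - 1) := Nat.mul_le_mul_right _ ht
  have h6 : 0 < L := lt_of_lt_of_le (Fin.pos_iff_nonempty.mpr ht0) ht
  have h7 : L * (K - 1) < L * K := Nat.mul_lt_mul_of_pos_left (by omega) h6
  omega

theorem eq_zero_of_sum_mul_choose_eq_zero {K : ℕ} (p : Fin K → ℚ)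
    (h : ∀ n : ℕ, ∑ k, p k * (n.choose k : ℚ) = 0) : p = 0 := by
  have key : ∀ n (hn : n < K), p ⟨n, hn⟩ = 0 := by
    intro n
    induction n using Nat.strong_induction_on with
    | _ n ih =>
      intro hn
      have := h n
      rw [sum_eq_single ⟨n, hn⟩] at this
      · simpa using this
      · intro k _ hk
        rcases lt_trichotomy (k : ℕ) n with h1 | h1 | h1
        · rw [ih k h1 k.2, zero_mul]
        · exact absurd (Fin.ext h1) hk
        · rw [Nat.choose_eq_zero_of_lt h1]; simp
      · simp
  ext k
  exact key k k.2

open Polynomial in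
theorem exists_polynomial_eval_eq_sum_choose {K : ℕ} (hK : 0 < K) (p : Fin K → ℚ) :
    ∃ Q : ℚ[X], Q.natDegree < K ∧
      ∀ n : ℕ, Q.eval (n : ℚ) = ∑ k, p k * (n.choose k : ℚ) := by
  refine ⟨∑ k : Fin K, C (p k / ((k : ℕ).factorial : ℚ)) * descPochhammer ℚ k, ?_, fun n => ?_⟩
  · refine lt_of_le_of_lt (natDegree_sum_le_of_forall_le (n := K - 1) _ _ fun k _ => ?_) (by omega)
    refine (natDegree_C_mul_le _ _).trans ?_
    rw [descPochhammer_natDegree]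
    omega
  · rw [eval_finsetSum]
    refine sum_congr rfl fun k _ => ?_
    rw [eval_mul, eval_C, descPochhammer_eval_eq_descFactorial,
      Nat.descFactorial_eq_factorial_mul_choose]
    have : ((k : ℕ).factorial : ℚ) ≠ 0 := by positivity
    push_cast
    field_simp

theorem eq_zero_of_interpolation_mulVec_eq_zero {K L S T q X c g : ℕ} (hX : 1 < X) (hc : 0 < c)
    (hg : 0 < g)
    (hK : 0 < K) (hST : L * K ≤ S * T) (hSq : S ≤ q) (p : Fin K × Fin L → ℚ)
    (h : ∀ u < T, ∀ v < S + L, ∑ a : Fin K × Fin L, ((v + u * q).choose a.1 : ℚ) *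
      ((X : ℚ) ^ (v * a.2) * (c : ℚ) ^ (u * a.2) * (g : ℚ) ^ (u * (L - 1 - a.2))) * p a = 0) :
    p = 0 := by
  choose Q hQ hQe using fun l : Fin L =>
    exists_polynomial_eval_eq_sum_choose hK fun k => p (k, l)
  have hQ0 : Q = 0 := by
    refine eq_zero_of_sum_eval_mul_pow_eq_zero (X : ℚ) ((c : ℚ) / g) (by exact_mod_cast hX)
      (by positivity) hK hST hSq Q hQ fun u hu v hv => ?_
    have hgu : (g : ℚ) ^ (u * (L - 1)) ≠ 0 := by positivity
    refine (mul_eq_zero.mp ?_).resolve_left hgu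
    rw [← h u hu v hv, Fintype.sum_prod_type_right, mul_sum]
    refine sum_congr rfl fun l _ => ?_
    rw [hQe, sum_mul, mul_sum]
    refine sum_congr rfl fun k _ => ?_
    have hl : L - 1 = (L - 1 - l) + l := by have := l.2; omega
    have hg' : (g : ℚ) ≠ 0 := by positivity
    have hw : (g : ℚ) ^ (u * (L - 1)) * ((X : ℚ) ^ v * (c / g) ^ u) ^ (l : ℕ) =
        (X : ℚ) ^ (v * l) * (c : ℚ) ^ (u * l) * (g : ℚ) ^ (u * (L - 1 - l)) := by
      nth_rw 1 [hl]
      rw [mul_add, pow_add, mul_pow, ← pow_mul, ← pow_mul, div_pow]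
      field_simp
    rw [← hw]
    ring
  ext ⟨k, l⟩
  have := eq_zero_of_sum_mul_choose_eq_zero (fun k => p (k, l)) fun n => by
    rw [← hQe, hQ0]; simp
  exact congrFun this k

theorem Matrix.exists_submatrix_det_ne_zero {ι κ : Type*} [Fintype ι] [Fintype κ] [DecidableEq κ]
    {F : Type*} [Field F] (M : Matrix ι κ F) (h : ∀ p, M.mulVec p = 0 → p = 0) :
    ∃ f : κ → ι, (M.submatrix f id).det ≠ 0 := by
  have hker : LinearMap.ker M.mulVecLin = ⊥ := by
    rw [LinearMap.ker_eq_bot']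
    exact h
  have hrank : M.rank = Fintype.card κ := by
    rw [Matrix.rank, LinearMap.finrank_range_of_inj (LinearMap.ker_eq_bot.mp hker),
      Module.finrank_fintype_fun_eq_card]
  obtain ⟨κ', a, ha, hspan, hli⟩ := exists_linearIndependent' F M.row
  have : Finite κ' := Finite.of_injective a ha
  have := Fintype.ofFinite κ'
  have hcard : Fintype.card κ = Fintype.card κ' := by
    rw [← hrank, Matrix.rank_eq_finrank_span_row, ← finrank_span_eq_card hli, hspan]
  let e := Fintype.equivOfCardEq hcard
  refine ⟨a ∘ e, ?_⟩
  have hrow : LinearIndependent F (M.submatrix (a ∘ e) id).row := hli.comp e e.injective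
  exact ((Matrix.isUnit_iff_isUnit_det _).mp
    (Matrix.linearIndependent_rows_iff_isUnit.mp hrow)).ne_zero

theorem Matrix.dvd_det_sub_det {ι : Type*} [Fintype ι] [DecidableEq ι] {d : ℤ}
    (A B : Matrix ι ι ℤ) (h : ∀ i j, d ∣ A i j - B i j) : d ∣ A.det - B.det := by
  rw [Matrix.det_apply, Matrix.det_apply, ← Finset.sum_sub_distrib]
  refine Finset.dvd_sum fun σ _ => ?_
  rw [← smul_sub, Units.smul_def, smul_eq_mul]
  refine Dvd.dvd.mul_left ?_ _
  exact Int.ModEq.dvd (Int.ModEq.prod fun i _ => (Int.modEq_iff_dvd.mpr (h _ _)))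

theorem two_mul_sum_range (n : ℕ) : 2 * ∑ i ∈ range n, i + n = n * n := by
  induction n with
  | zero => simp
  | succ n ih => rw [sum_range_succ]; linarith

/-- The entries of the interpolation matrix: the row `(u, v)` belongs to the integer `v + u * q`,
the column `(k, l)` to the function `z ↦ choose z k * X ^ (l * z)`. -/
def interpolationMatrix (K L R T q : ℕ) (X c g : ℤ) :
    Matrix (Fin T × Fin R) (Fin K × Fin L) ℤ :=
  Matrix.of fun i a => (((i.2 : ℕ) + (i.1 : ℕ) * q).choose (a.1 : ℕ) : ℤ) *
    (X ^ ((i.2 : ℕ) * a.2) * c ^ ((i.1 : ℕ) * a.2) * g ^ ((i.1 : ℕ) * (L - 1 - a.2)))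

theorem pow_dvd_det_interpolationMatrix {K L R T q W G : ℕ} {X c g y : ℤ} (hX : y ∣ X - 1)
    (hc : y ^ W ∣ g * X ^ q - c) (hGW : G ≤ W) (hG : 2 * G + K * L * K = (K * L) ^ 2)
    (f : Fin K × Fin L → Fin T × Fin R) :
    y ^ G ∣ ((interpolationMatrix K L R T q X c g).submatrix f id).det := by
  let z : Fin K × Fin L → ℕ := fun i => ((f i).2 : ℕ) + ((f i).1 : ℕ) * q
  let B : Matrix (Fin K × Fin L) (Fin K × Fin L) ℤ := Matrix.of fun i a =>
    g ^ (((f i).1 : ℕ) * (L - 1)) * (Matrix.of fun i a : Fin K × Fin L =>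
      ((z i).choose (a.1 : ℕ) : ℤ) * X ^ ((a.2 : ℕ) * z i)) i a
  have hB : y ^ G ∣ B.det := by
    rw [Matrix.det_mul_column]
    refine Dvd.dvd.mul_left (pow_dvd_det_choose_mul_pow z (fun a => (a.1 : ℕ))
      (fun a => (a.2 : ℕ)) hX ?_) _
    have h1 : ∑ a : Fin K × Fin L, (a.1 : ℕ) = L * ∑ k ∈ range K, k := by
      rw [Fintype.sum_prod_type, mul_sum, sum_range]
      simp
    have h2 := two_mul_sum_range K
    have h3 := two_mul_sum_range (K * L)
    rw [h1, Fintype.card_prod, Fintype.card_fin, Fintype.card_fin]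
    nlinarith
  have hAB : y ^ G ∣ ((interpolationMatrix K L R T q X c g).submatrix f id).det - B.det := by
    refine Matrix.dvd_det_sub_det _ _ fun i a => ?_
    have hmod : c ≡ g * X ^ q [ZMOD y ^ G] :=
      Int.modEq_iff_dvd.mpr ((pow_dvd_pow y hGW).trans hc)
    have hL : L - 1 = (L - 1 - a.2) + a.2 := by have := a.2.2; omega
    have hval : B i a = ((z i).choose (a.1 : ℕ) : ℤ) * (X ^ (((f i).2 : ℕ) * a.2) *
        (g * X ^ q) ^ (((f i).1 : ℕ) * a.2) * g ^ (((f i).1 : ℕ) * (L - 1 - a.2))) := by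
      simp only [B, Matrix.of_apply, z]
      nth_rw 1 [hL]
      ring
    rw [hval]
    exact (Int.ModEq.mul_left _ (((hmod.pow _).mul_left _).mul_right _)).symm.dvd
  exact (dvd_iff_dvd_of_dvd_sub hAB).mpr hB

theorem interpolation_inequality {K L S T q X c g y W m Q : ℕ} (hy : 1 < y) (hX : 1 < X)
    (hc : 0 < c) (hg : 0 < g) (hK : 0 < K) (hL : 0 < L) (hST : L * K ≤ S * T) (hSq : S + L ≤ q)
    (hXy : (y : ℤ) ∣ X - 1) (hXm : X ≤ y ^ m) (hcy : c ≤ y) (hgy : g ≤ y ^ 2)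
    (hcong : (y : ℤ) ^ W ∣ g * X ^ q - c) (hW : (K * L) ^ 2 ≤ 2 * W + K * L * K)
    (hT : T * q ≤ y ^ Q) (hN : K * L ≤ y ^ Q) :
    K * L ≤ K + (Q * (K - 1) + (m * (S + L) + 3 * T) * (L - 1) + 2 * Q) := by
  obtain ⟨G, hG⟩ : ∃ G, 2 * G + K * L * K = (K * L) ^ 2 := by
    refine ⟨K ^ 2 * ∑ i ∈ range L, i, ?_⟩
    linear_combination K ^ 2 * two_mul_sum_range L
  have hGW : G ≤ W := by omega
  let M := (interpolationMatrix K L (S + L) T q X c g)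
  obtain ⟨f, hf⟩ := Matrix.exists_submatrix_det_ne_zero (M.map (Int.cast : ℤ → ℚ))
    fun p hp => eq_zero_of_interpolation_mulVec_eq_zero hX hc hg hK hST
      ((Nat.le_add_right _ _).trans hSq) p fun u hu v hv => by
        have := congrFun hp (⟨u, hu⟩, ⟨v, hv⟩)
        simpa [M, interpolationMatrix, Matrix.mulVec, dotProduct] using this
  have hdet : (M.submatrix f id).det ≠ 0 := fun h0 => hf (by
    have := congrArg (Int.castRingHom ℚ) h0
    rwa [RingHom.map_det, map_zero] at this)
  have hdvd : (y : ℤ) ^ G ∣ (M.submatrix f id).det :=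
    pow_dvd_det_interpolationMatrix hXy hcong hGW hG f
  let e : Fin K × Fin L → ℕ := fun a =>
    Q * a.1 + (m * ((S + L) * a.2) + (T * a.2 + 2 * (T * (L - 1 - a.2))))
  have hentry : ∀ i a, |(M.submatrix f id) i a| ≤ (y : ℤ) ^ e a := by
    intro i a
    have hz : ((f i).2 : ℕ) + ((f i).1 : ℕ) * q ≤ y ^ Q := by
      refine le_trans ?_ hT
      have h1 := (f i).2.2
      have h2 : ((f i).1 + 1) * q ≤ T * q := Nat.mul_le_mul_right _ (f i).1.2
      rw [add_mul] at h2
      omega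
    have hnat : (((f i).2 : ℕ) + ((f i).1 : ℕ) * q : ℕ).choose (a.1 : ℕ) *
        (X ^ (((f i).2 : ℕ) * a.2) * c ^ (((f i).1 : ℕ) * a.2) *
          g ^ (((f i).1 : ℕ) * (L - 1 - a.2))) ≤
        y ^ e a := by
      have hy0 : 0 < y := by omega
      simp only [e, pow_add, pow_mul y]
      rw [mul_assoc (X ^ _)]
      refine Nat.mul_le_mul ((Nat.choose_le_pow _ _).trans (Nat.pow_le_pow_left hz _))
        (Nat.mul_le_mul ?_ (Nat.mul_le_mul ?_ ?_))
      · exact (Nat.pow_le_pow_left hXm _).trans (Nat.pow_le_pow_right (by positivity)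
          (Nat.mul_le_mul_right _ (f i).2.2.le))
      · rw [← pow_mul y T]
        exact (Nat.pow_le_pow_left hcy _).trans (Nat.pow_le_pow_right hy0
          (Nat.mul_le_mul_right _ (f i).1.2.le))
      · exact (Nat.pow_le_pow_left hgy _).trans (Nat.pow_le_pow_right (by positivity)
          (Nat.mul_le_mul_right _ (f i).1.2.le))
    have : (M.submatrix f id) i a = (((((f i).2 : ℕ) + ((f i).1 : ℕ) * q : ℕ).choose (a.1 : ℕ) *
        (X ^ (((f i).2 : ℕ) * a.2) * c ^ (((f i).1 : ℕ) * a.2) *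
          g ^ (((f i).1 : ℕ) * (L - 1 - a.2))) : ℕ) : ℤ) := by
      simp [M, interpolationMatrix]
    rw [this, abs_of_nonneg (by positivity)]
    exact_mod_cast hnat
  have hbound := abs_det_le_factorial_mul_prod _ _ hentry
  have hle : (y : ℤ) ^ G ≤ |(M.submatrix f id).det| :=
    Int.le_of_dvd (abs_pos.mpr hdet) ((dvd_abs _ _).mpr hdvd)
  have hfac : (K * L).factorial ≤ y ^ (Q * (K * L)) := by
    rw [pow_mul]
    exact (Nat.factorial_le_pow _).trans (Nat.pow_le_pow_left hN _)
  rw [prod_pow_eq_pow_sum, Fintype.card_prod, Fintype.card_fin, Fintype.card_fin] at hbound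
  have hfinal : y ^ G ≤ y ^ (Q * (K * L) + ∑ a, e a) := by
    rw [pow_add]
    refine le_trans ?_ (Nat.mul_le_mul_right _ hfac)
    exact_mod_cast hle.trans hbound
  have hexp := (Nat.pow_le_pow_iff_right hy).mp hfinal
  have hsum : 2 * ∑ a, e a =
      K * L * (Q * (K - 1) + (m * (S + L) + 3 * T) * (L - 1)) := by
    have h1 : ∑ a, e a = L * (Q * ∑ k ∈ range K, k) +
        K * ((m * (S + L) + 3 * T) * ∑ l ∈ range L, l) := by
      have h2 : ∑ l : Fin L, (L - 1 - (l : ℕ)) = ∑ l ∈ range L, l := by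
        rw [← sum_range_reflect, sum_range fun l => L - 1 - l]
      simp only [e, Fintype.sum_prod_type, sum_add_distrib, ← mul_sum, sum_const, h2, card_univ,
        Fintype.card_fin, smul_eq_mul, sum_range]
      ring
    obtain ⟨K, rfl⟩ := Nat.exists_eq_succ_of_ne_zero hK.ne'
    obtain ⟨L, rfl⟩ := Nat.exists_eq_succ_of_ne_zero hL.ne'
    have h3 := two_mul_sum_range (K + 1)
    have h4 := two_mul_sum_range (L + 1)
    have h5 : 2 * ∑ i ∈ range (K + 1), i = (K + 1) * K := by linarith
    have h6 : 2 * ∑ i ∈ range (L + 1), i = (L + 1) * L := by linarith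
    rw [h1]
    simp only [Nat.succ_eq_add_one, Nat.add_sub_cancel]
    linear_combination (L + 1) * Q * h5 + (K + 1) * (m * (S + (L + 1)) + 3 * T) * h6
  have hpos : 0 < K * L := Nat.mul_pos hK hL
  refine Nat.le_of_mul_le_mul_left (?_ : K * L * _ ≤ K * L * _) hpos
  linarith

/-- Binary search for the integer `y < r + 2 ^ k` with `y ^ m < s ≤ (y + 1) ^ m`. -/
def rootSearch (m s : ℕ) : ℕ → ℕ → ℕ
  | 0, r => r
  | k + 1, r => rootSearch m s k (if (r + 2 ^ k) ^ m < s then r + 2 ^ k else r)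

theorem rootSearch_eq {m s y : ℕ} (h1 : y ^ m < s) (h2 : s ≤ (y + 1) ^ m) (k r : ℕ) (hr : r ≤ y)
    (hy : y < r + 2 ^ k) : rootSearch m s k r = y := by
  induction k generalizing r with
  | zero => simp [rootSearch]; simp at hy; omega
  | succ k ih =>
    rw [rootSearch]
    have hp : 2 ^ (k + 1) = 2 ^ k + 2 ^ k := by ring
    split_ifs with h
    · refine ih _ ?_ (by omega)
      have := lt_of_pow_lt_pow_left₀ m (by positivity) (h.trans_le h2)
      omega
    · refine ih _ hr ?_
      have : y ^ m < (r + 2 ^ k) ^ m := h1.trans_le (not_lt.mp h)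
      exact lt_of_pow_lt_pow_left₀ m (by positivity) this

/-- No `y < 2 ^ 13` satisfies `x + ⋯ + x ^ n = y + ⋯ + y ^ m` and `x ∣ y ^ m - 1`, apart from
`2 + ⋯ + 2 ^ 4 = 5 + 5 ^ 2`. -/
def noSolution (m n x : ℕ) : Bool :=
  let s := x * ((x ^ n - 1) / (x - 1))
  let y := rootSearch m s 13 0
  (y - 1) * s != y * (y ^ m - 1) || (y ^ m - 1) % x != 0 || (x == 2 && n == 4 && m == 2)

def noSolutionFrom (b m n : ℕ) : ℕ → ℕ → Bool
  | 0, _ => true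
  | k + 1, x => if b ≤ x ^ n then true else noSolution m n x && noSolutionFrom b m n k (x + 1)

theorem noSolution_of_noSolutionFrom {b m n k x z : ℕ} (h : noSolutionFrom b m n k x = true)
    (hxz : x ≤ z) (hz : z < x + k) (hb : z ^ n < b) : noSolution m n z = true := by
  induction k generalizing x with
  | zero => omega
  | succ k ih =>
    rw [noSolutionFrom] at h
    split_ifs at h with hbx
    · exact absurd (hbx.trans (Nat.pow_le_pow_left hxz n)) (not_le.mpr hb)
    · rw [Bool.and_eq_true] at h
      rcases hxz.eq_or_lt with rfl | hlt
      · exact h.1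
      · exact ih h.2 hlt (by omega)

/-- An upper bound for `x ^ n` that is sufficient for the finite search with exponent `m`. -/
def searchBound (m : ℕ) : ℕ :=
  if m = 2 then 25 * 10 ^ 6 else if m = 3 then 7 * 10 ^ 7 else if m = 4 then 4 * 10 ^ 8
  else if m = 5 then 10 ^ 9 else 2 * 10 ^ 12

theorem noSolutionFrom_searchBound : ∀ m < 40, 2 ≤ m → ∀ n < 42, m < n →
    noSolutionFrom (searchBound m) m n 300 2 = true := by
  decide +kernel

theorem searchBound_spec : ∀ m < 40, 2 ≤ m →
    searchBound m ≤ 2 ^ 42 ∧ searchBound m ≤ 302 ^ (m + 1) ∧ 2 * searchBound m ≤ (2 ^ 13) ^ m := by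
  decide +kernel

theorem searchBound_large : ∀ m < 40, 2 ≤ m → ∀ Q < 41, m < Q →
    24200 * m ^ 2 * (Q + 1) ^ 4 ≤ (m - 1) * searchBound m ∨
    (242000 * m ^ 3 * Q * (Q + 1) ^ 4) ^ m ≤ searchBound m ^ (Q - 1) * (m - 1) ^ m ∨
    242000 * m ^ 3 * Q * (Q + 1) ^ 4 ≤ 3 ^ (Q - 1) * (m - 1) := by
  decide +kernel

theorem polynomial_le_three_pow {Q : ℕ} (hQ : 40 ≤ Q) :
    484000 * Q ^ 3 * (Q + 1) ^ 4 ≤ 3 ^ (Q - 1) := by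
  induction Q, hQ using Nat.le_induction with
  | base => norm_num
  | succ Q hQ ih =>
    obtain ⟨P, rfl⟩ := Nat.exists_eq_add_of_le' (show 1 ≤ Q by omega)
    simp only [Nat.add_sub_cancel, pow_succ 3 P] at *
    have h1 : 40 * (P + 2) ≤ 41 * (P + 1) := by omega
    have h2 : 40 * (P + 3) ≤ 41 * (P + 2) := by omega
    have h3 := Nat.mul_le_mul (Nat.pow_le_pow_left h1 3) (Nat.pow_le_pow_left h2 4)
    have h4 : 484000 * (P + 2) ^ 3 * (P + 3) ^ 4 ≤
        (484000 * (P + 1) ^ 3 * (P + 2) ^ 4) * 3 := by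
      have h5 : 40 ^ 7 * ((P + 2) ^ 3 * (P + 3) ^ 4) ≤ 41 ^ 7 * ((P + 1) ^ 3 * (P + 2) ^ 4) := by
        calc _ = _ := by ring
          _ ≤ _ := h3
          _ = _ := by ring
      rw [mul_assoc, mul_assoc 484000]
      omega
    exact h4.trans (Nat.mul_le_mul_right _ ih)

theorem eq_of_lt_searchBound {x y m n κ : ℕ} (hx : 2 ≤ x) (hxy : x < y) (hm : 2 ≤ m) (hmn : m < n)
    (hm40 : m < 40) (hX : x ^ n = 1 + (x - 1) * y * κ) (hY : y ^ m = 1 + (y - 1) * x * κ)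
    (hb : x ^ n < searchBound m) (hYX : y ^ m < 2 * x ^ n) : x = 2 ∧ y = 5 ∧ m = 2 ∧ n = 4 := by
  obtain ⟨hb1, hb2, hb3⟩ := searchBound_spec m hm40 hm
  have hn : n < 42 := (Nat.pow_lt_pow_iff_right (a := 2) (by norm_num)).mp
    ((Nat.pow_le_pow_left hx n).trans_lt (hb.trans_le hb1))
  have hx302 : x < 302 := by
    by_contra! h
    have h1 : 302 ^ (m + 1) ≤ x ^ n :=
      (Nat.pow_le_pow_left h _).trans (Nat.pow_le_pow_right (by omega) hmn)
    omega
  have hy13 : y < 2 ^ 13 := lt_of_pow_lt_pow_left₀ m (by positivity) (by omega)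
  have hs : x * ((x ^ n - 1) / (x - 1)) = x * y * κ := by
    rw [hX, Nat.add_sub_cancel_left, mul_assoc, Nat.mul_div_cancel_left _ (by omega)]
    ring
  have hκ : 0 < κ := by
    rcases Nat.eq_zero_or_pos κ with rfl | h
    · have := Nat.one_lt_pow (by omega : m ≠ 0) (by omega : 1 < y)
      simp at hY; omega
    · exact h
  obtain ⟨z, rfl⟩ : ∃ z, y = z + 1 := ⟨y - 1, by omega⟩
  simp only [Nat.add_sub_cancel] at hY
  have hxκ : 2 ≤ x * κ := hx.trans (Nat.le_mul_of_pos_right _ hκ)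
  have h1 : (z + 1) ^ m < x * (z + 1) * κ := by
    rw [hY]; nlinarith
  have h2 : x * (z + 1) * κ ≤ (z + 1 + 1) ^ m := by
    have key : ∀ j, (z + 1) * (z + 1) ^ (j + 2) ≤ z * (z + 2) ^ (j + 2) + (z + 1) := by
      intro j
      induction j with
      | zero => ring_nf; nlinarith
      | succ j ih =>
        have : (z + 1) * (z + 1) ≤ (z + 1) * (z + 1) ^ (j + 2) :=
          Nat.mul_le_mul_left _ (Nat.le_self_pow (by omega) _)
        rw [pow_succ (z + 1) (j + 2), pow_succ (z + 2) (j + 2)]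
        nlinarith
    obtain ⟨j, rfl⟩ := Nat.exists_eq_add_of_le' hm
    have h3 := key j
    rw [hY] at h3
    have hz : 0 < z := by omega
    refine Nat.le_of_mul_le_mul_left ?_ hz
    calc z * (x * (z + 1) * κ) = (z + 1) * (z * x * κ) := by ring
      _ ≤ z * (z + 1 + 1) ^ (j + 2) := by
        show _ ≤ z * (z + 2) ^ (j + 2)
        linarith
  have hroot := rootSearch_eq h1 h2 13 0 (by omega) (by omega)
  have hno := noSolution_of_noSolutionFrom (noSolutionFrom_searchBound m hm40 hm n hn hmn) hx
    (by omega) hb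
  simp only [noSolution, hs, hroot, Bool.or_eq_true, Bool.and_eq_true, beq_iff_eq, bne_iff_ne,
    Nat.add_sub_cancel, hY, Nat.add_sub_cancel_left] at hno
  rcases hno with (h | h) | ⟨⟨rfl, rfl⟩, rfl⟩
  · exact absurd (by ring) h
  · exact absurd (Nat.mod_eq_zero_of_dvd ⟨z * κ, by ring⟩) h
  · refine ⟨rfl, ?_, rfl, rfl⟩
    have h15 : (z + 1) * κ = 15 := by norm_num at hX; omega
    have hz : z ≤ 14 := Nat.le_of_succ_le_succ (Nat.le_of_dvd (by norm_num) ⟨κ, h15.symm⟩)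
    interval_cases z <;> omega

theorem lt_of_mul_le_pow {X q c g y W m Q : ℕ} (hy : 1 < y) (hX : 1 < X) (hm : 2 ≤ m)
    (hc : 0 < c) (hg : 0 < g)
    (hXy : (y : ℤ) ∣ X - 1) (hXm : X ≤ y ^ m) (hcy : c ≤ y) (hgy : g ≤ y ^ 2)
    (hcong : (y : ℤ) ^ W ∣ g * X ^ q - c) (hW : q * (m - 1) ≤ W)
    (hQ : 10 * m * (Q + 1) * q ≤ y ^ Q) : q * (m - 1) < 24200 * m ^ 2 * (Q + 1) ^ 4 := by
  by_contra! h
  have hL : 12 * (2 * (Q + 1)) ≤ q := by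
    have h1 : 24 * m ^ 2 * (Q + 1) ≤ 24200 * m ^ 2 * (Q + 1) ^ 4 :=
      Nat.mul_le_mul (Nat.mul_le_mul_right _ (by norm_num)) (Nat.le_self_pow (by norm_num) _)
    have h2 : q * (m - 1) ≤ q * m ^ 2 :=
      Nat.mul_le_mul_left _ ((Nat.sub_le _ _).trans (Nat.le_self_pow (by norm_num) _))
    have h3 : 0 < m ^ 2 := by positivity
    refine Nat.le_of_mul_le_mul_right (c := m ^ 2) ?_ h3
    calc _ = 24 * m ^ 2 * (Q + 1) := by ring
      _ ≤ _ := h1.trans (h.trans h2)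
  have key := interpolation_inequality (K := 55 * m * (2 * (Q + 1))) (L := 2 * (Q + 1))
    (S := 11 * (2 * (Q + 1))) (T := 5 * m * (2 * (Q + 1))) (Q := Q) hy hX hc hg (by positivity)
    (by positivity) (by apply le_of_eq; ring) (by omega) hXy hXm hcy hgy hcong ?_ ?_ ?_
  · obtain ⟨L, hL⟩ : ∃ L, 2 * (Q + 1) = L + 1 := ⟨2 * Q + 1, rfl⟩
    have hK : 55 * m * (2 * (Q + 1)) - 1 ≤ 55 * m * (2 * (Q + 1)) := Nat.sub_le _ _
    have h5 := Nat.mul_le_mul_left Q hK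
    have h6 : 2 * (Q + 1) - 1 = 2 * Q + 1 := rfl
    rw [h6] at key
    have h7 : 0 < m * (2 * (Q + 1)) := by positivity
    nlinarith
  · have : (55 * m * (2 * (Q + 1)) * (2 * (Q + 1))) ^ 2 = 2 * (24200 * m ^ 2 * (Q + 1) ^ 4) := by
      ring
    omega
  · calc _ = 10 * m * (Q + 1) * q := by ring
      _ ≤ _ := hQ
  · calc 55 * m * (2 * (Q + 1)) * (2 * (Q + 1)) = 10 * m * (Q + 1) * (11 * (2 * (Q + 1))) := by ring
      _ ≤ 10 * m * (Q + 1) * q := Nat.mul_le_mul_left _ (by omega)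
      _ ≤ _ := hQ

theorem lt_searchBound {X y m q : ℕ} (hy : 3 ≤ y) (hm : 2 ≤ m) (hX : X < q) (hXY : X < y ^ m)
    (hYX : y ^ m < 2 * X)
    (h : ∀ Q, 10 * m * (Q + 1) * q ≤ y ^ Q → q * (m - 1) < 24200 * m ^ 2 * (Q + 1) ^ 4) :
    m < 40 ∧ X < searchBound m := by
  have hex : ∃ Q, 10 * m * (Q + 1) * q ≤ y ^ Q := by
    refine ⟨2 * (10 * m * q), ?_⟩
    have h1 : 10 * m * q < 3 ^ (10 * m * q) := Nat.lt_pow_self (by norm_num)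
    have h2 : 1 + 10 * m * q * 2 ≤ 3 ^ (10 * m * q) := by
      have := one_add_mul_le_pow (a := (2 : ℤ)) (by norm_num) (10 * m * q)
      norm_num at this
      exact_mod_cast this
    calc 10 * m * (2 * (10 * m * q) + 1) * q = 10 * m * q * (1 + 10 * m * q * 2) := by ring
      _ ≤ 3 ^ (10 * m * q) * 3 ^ (10 * m * q) := Nat.mul_le_mul h1.le h2
      _ = 3 ^ (2 * (10 * m * q)) := by rw [two_mul, pow_add]
      _ ≤ _ := Nat.pow_le_pow_left hy _
  classical
  let Q := Nat.find hex
  have hQ : 10 * m * (Q + 1) * q ≤ y ^ Q := Nat.find_spec hex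
  have hq : 0 < q := by omega
  have hmQ : m < Q := by
    refine (Nat.pow_lt_pow_iff_right (a := y) (by omega)).mp ?_
    have : 2 * q ≤ 10 * m * (Q + 1) * q := Nat.mul_le_mul_right _ (by nlinarith)
    omega
  have hQmin : y ^ (Q - 1) < 10 * m * Q * q := by
    have := Nat.find_min hex (show Q - 1 < Q by omega)
    rwa [not_le, Nat.sub_add_cancel (by omega : 1 ≤ Q)] at this
  have hqQ := h Q hQ
  obtain ⟨k, rfl⟩ : ∃ k, m = k + 1 := ⟨m - 1, by omega⟩
  simp only [Nat.add_sub_cancel] at hqQ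
  have hk : 0 < k := by omega
  have hmain : y ^ (Q - 1) * k < 242000 * (k + 1) ^ 3 * Q * (Q + 1) ^ 4 := by
    calc y ^ (Q - 1) * k < 10 * (k + 1) * Q * q * k := Nat.mul_lt_mul_of_pos_right hQmin hk
      _ = 10 * (k + 1) * Q * (q * k) := by ring
      _ ≤ 10 * (k + 1) * Q * (24200 * (k + 1) ^ 2 * (Q + 1) ^ 4) := Nat.mul_le_mul_left _ hqQ.le
      _ = _ := by ring
  have h3 : 3 ^ (Q - 1) * k < 242000 * (k + 1) ^ 3 * Q * (Q + 1) ^ 4 :=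
    (Nat.mul_le_mul_right _ (Nat.pow_le_pow_left hy _)).trans_lt hmain
  have hQ40 : Q < 40 := by
    by_contra! hge
    have h4 := polynomial_le_three_pow hge
    have h5 : (k + 1) ^ 3 ≤ 2 * Q ^ 2 * k := by
      have h6 : (k + 1) ^ 2 ≤ Q ^ 2 := Nat.pow_le_pow_left (by omega) 2
      calc (k + 1) ^ 3 = (k + 1) ^ 2 * (k + 1) := by ring
        _ ≤ Q ^ 2 * (2 * k) := Nat.mul_le_mul h6 (by omega)
        _ = _ := by ring
    have h7 : 242000 * (k + 1) ^ 3 * Q * (Q + 1) ^ 4 ≤ 3 ^ (Q - 1) * k := by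
      calc 242000 * (k + 1) ^ 3 * Q * (Q + 1) ^ 4 ≤ 242000 * (2 * Q ^ 2 * k) * Q * (Q + 1) ^ 4 := by
            gcongr
        _ = 484000 * Q ^ 3 * (Q + 1) ^ 4 * k := by ring
        _ ≤ _ := Nat.mul_le_mul_right _ h4
    omega
  refine ⟨by omega, ?_⟩
  by_contra! hge
  rcases searchBound_large (k + 1) (by omega) hm Q (by omega) hmQ with h' | h' | h'
  · simp only [Nat.add_sub_cancel] at h'
    have : k * searchBound (k + 1) ≤ q * k := by
      rw [mul_comm]; exact Nat.mul_le_mul_right _ (by omega)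
    omega
  · simp only [Nat.add_sub_cancel] at h'
    have h8 : searchBound (k + 1) ^ (Q - 1) ≤ (y ^ (k + 1)) ^ (Q - 1) :=
      Nat.pow_le_pow_left (by omega) _
    have h9 := Nat.pow_lt_pow_left hmain (n := k + 1) (by omega)
    have h10 : searchBound (k + 1) ^ (Q - 1) * k ^ (k + 1) ≤ (y ^ (Q - 1) * k) ^ (k + 1) := by
      rw [mul_pow, ← pow_mul, mul_comm (Q - 1), pow_mul]
      exact Nat.mul_le_mul_right _ h8
    omega
  · simp only [Nat.add_sub_cancel] at h'
    omega

/-- If all primes dividing the odd number `D` divide `X - 1`, and `D` divides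
`(X ^ n - 1) / (X - 1)`, then `D` divides `n`. -/
theorem dvd_of_odd_of_pow_eq {X D n κ : ℕ} (hX : 1 < X) (hD : Odd D) (hn : 0 < n)
    (hp : ∀ p, p.Prime → p ∣ D → p ∣ X - 1) (h : X ^ n = 1 + (X - 1) * D * κ) : D ∣ n := by
  have hκ : κ ≠ 0 := by
    rintro rfl
    have := Nat.one_lt_pow hn.ne' hX
    simp at h; omega
  have hD0 : D ≠ 0 := hD.pos.ne'
  rw [← Nat.factorization_le_iff_dvd hD0 hn.ne']
  intro p
  by_cases hpp : p.Prime
  swap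
  · simp [hpp]
  by_cases hpD : p ∣ D
  swap
  · simp [Nat.factorization_eq_zero_of_not_dvd hpD]
  have := Fact.mk hpp
  have hodd : Odd p := Odd.of_dvd_nat hD hpD
  have hpX := hp p hpp hpD
  have hnX : ¬ p ∣ X := fun h' => hpp.one_lt.ne' (Nat.dvd_one.mp (by
    have := (Nat.dvd_sub h' hpX); rwa [Nat.sub_sub_self hX.le] at this))
  have h1 := padicValNat.pow_sub_pow (p := p) hodd hX (by simpa using hpX) hnX hn.ne'
  rw [one_pow, h, Nat.add_sub_cancel_left, mul_assoc, padicValNat.mul (by omega)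
    (Nat.mul_ne_zero hD0 hκ), padicValNat.mul hD0 hκ] at h1
  simp only [Nat.factorization_def _ hpp]
  omega

theorem two_mul_eq_add_pow_absurd {q M : ℕ} (hq : 16 < q) (h : 8 * 16 ^ q = 3 + 5 * 25 ^ M) :
    False := by
  have h1 : 25 ^ M ≡ 25 ^ (M % 32) [MOD 256 * 641] := by
    conv_lhs => rw [← Nat.div_add_mod M 32, pow_add, pow_mul]
    have : 25 ^ 32 ≡ 1 [MOD 256 * 641] := by decide
    simpa using (this.pow (M / 32)).mul_right (25 ^ (M % 32))
  have h2 : 16 ^ q ≡ 16 ^ (q % 16) [MOD 641] := by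
    conv_lhs => rw [← Nat.div_add_mod q 16, pow_add, pow_mul]
    have : 16 ^ 16 ≡ 1 [MOD 641] := by decide
    simpa using (this.pow (q / 16)).mul_right (16 ^ (q % 16))
  have h3 : 8 * 16 ^ q ≡ 0 [MOD 256] := by
    obtain ⟨k, rfl⟩ := Nat.exists_eq_add_of_lt hq
    refine (Nat.modEq_zero_iff_dvd).mpr ⟨8 * 16 ^ (k + 15), ?_⟩
    ring
  have h4 : 3 + 5 * 25 ^ (M % 32) ≡ 0 [MOD 256] :=
    (((h1.of_mul_right _).mul_left 5).add_left 3).symm.trans (h ▸ h3)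
  have h5 : 3 + 5 * 25 ^ (M % 32) ≡ 8 * 16 ^ (q % 16) [MOD 641] :=
    (((h1.of_mul_left _).mul_left 5).add_left 3).symm.trans (h ▸ h2.mul_left 8)
  have hM : M % 32 < 32 := Nat.mod_lt _ (by norm_num)
  have hq' : q % 16 < 16 := Nat.mod_lt _ (by norm_num)
  generalize M % 32 = b at *
  generalize q % 16 = a at *
  have key : ∀ b < 32, 3 + 5 * 25 ^ b ≡ 0 [MOD 256] → b = 17 := by decide +kernel
  obtain rfl := key b hM h4
  have key' : ∀ a < 16, ¬ 3 + 5 * 25 ^ 17 ≡ 8 * 16 ^ a [MOD 641] := by decide +kernel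
  exact key' a hq' h5

theorem repunit_system_bounds {a b X Y N M κ κ' : ℕ} (ha : 0 < a) (hab : a < b) (hκ : 0 < κ)
    (hN : 0 < N) (h1 : X = 1 + a * (b + 1) * κ) (h2 : Y = 1 + b * (a + 1) * κ)
    (h3 : X ^ N = 1 + (X - 1) * Y * κ') (h4 : Y ^ M = 1 + (Y - 1) * X * κ') :
    X < Y ∧ Y < 2 * X ∧ M ≤ N ∧
      b * (a + 1) * X ^ (N + 1) = (b - a) + a * (b + 1) * Y ^ (M + 1) ∧
      X ^ (N + 1) < Y ^ (M + 1) := by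
  have hXY : X < Y := by rw [h1, h2]; nlinarith
  have hle : b * (a + 1) ≤ 2 * (a * (b + 1)) := by nlinarith
  have hYX : Y < 2 * X := by
    have := Nat.mul_le_mul_right κ hle
    rw [h1, h2]
    linarith
  have h5 : X - 1 = a * (b + 1) * κ := by omega
  have h6 : Y - 1 = b * (a + 1) * κ := by omega
  rw [h5] at h3
  rw [h6] at h4
  have hX1 : 1 < X := by
    have : 0 < a * (b + 1) * κ := by positivity
    omega
  have hMN : M ≤ N := by
    by_contra! hlt
    have h7 : Y * Y ^ N ≤ Y ^ M := by
      rw [← pow_succ']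
      exact Nat.pow_le_pow_right (by omega) hlt
    have h8 : 2 * X ^ N ≤ Y * Y ^ N := Nat.mul_le_mul (by omega) (Nat.pow_le_pow_left hXY.le _)
    have h9 : b * (a + 1) * κ * X * κ' ≤ 2 * (a * (b + 1) * κ * Y * κ') := by
      calc b * (a + 1) * κ * X * κ' ≤ 2 * (a * (b + 1)) * κ * Y * κ' := by gcongr
        _ = _ := by ring
    omega
  have hid : b * (a + 1) * X ^ (N + 1) = (b - a) + a * (b + 1) * Y ^ (M + 1) := by
    obtain ⟨d, rfl⟩ := Nat.exists_eq_add_of_le hab.le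
    rw [Nat.add_sub_cancel_left, pow_succ, pow_succ, h3, h4, h1, h2]
    ring
  refine ⟨hXY, hYX, hMN, hid, ?_⟩
  by_contra! hge
  have hX2 : 1 < X ^ (N + 1) := Nat.one_lt_pow (by omega) hX1
  obtain ⟨d, rfl⟩ := Nat.exists_eq_add_of_lt hab
  have h7 : a + d + 1 - a = d + 1 := by omega
  rw [h7] at hid
  have := Nat.mul_le_mul_left (a * (a + d + 1 + 1)) hge
  nlinarith

/-- The system of equations attached to two solutions of `(x ^ N - 1) / (x - 1) =
(y ^ M - 1) / (y - 1)`, the larger of which is generated by the smaller one. -/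
theorem repunit_system_absurd {x y n m N M κ κ' : ℕ} (hx : 2 ≤ x) (hxy : x < y)
    (hcop : x.Coprime y) (hn : 0 < n) (hm : 0 < m) (hN : 0 < N) (hM : 0 < M)
    (h1 : x ^ n = 1 + (x - 1) * y * κ) (h2 : y ^ m = 1 + (y - 1) * x * κ)
    (h3 : (x ^ n) ^ N = 1 + (x ^ n - 1) * y ^ m * κ')
    (h4 : (y ^ m) ^ M = 1 + (y ^ m - 1) * x ^ n * κ') : False := by
  have hX1 : 1 < x ^ n := Nat.one_lt_pow hn.ne' hx
  have hY1 : 1 < y ^ m := Nat.one_lt_pow hm.ne' (by omega)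
  have hm2 : 2 ≤ m := by
    by_contra! hlt
    obtain rfl : m = 1 := by omega
    rw [pow_one] at h2
    have : 0 < y - 1 := by omega
    rw [mul_assoc] at h2
    have h5 : (y - 1) * (x * κ) = (y - 1) * 1 := by omega
    have h6 := Nat.eq_of_mul_eq_mul_left this h5
    have := Nat.eq_one_of_mul_eq_one_right h6
    omega
  have hκ : 0 < κ := by
    rcases Nat.eq_zero_or_pos κ with rfl | h
    · simp at h2; omega
    · exact h
  obtain ⟨a, rfl⟩ : ∃ a, x = a + 1 := ⟨x - 1, by omega⟩
  obtain ⟨b, rfl⟩ : ∃ b, y = b + 1 := ⟨y - 1, by omega⟩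
  simp only [Nat.add_sub_cancel] at h1 h2
  obtain ⟨X, hX⟩ : ∃ X, X = (a + 1) ^ n := ⟨_, rfl⟩
  obtain ⟨Y, hY⟩ : ∃ Y, Y = (b + 1) ^ m := ⟨_, rfl⟩
  rw [← hX] at h1 h3 h4 hX1
  rw [← hY] at h2 h3 h4 hY1
  obtain ⟨hXY, hYX, hMN, hid, hlt⟩ := repunit_system_bounds (by omega) (by omega) hκ hN h1 h2 h3 h4
  have hmn : m < n := by
    by_contra! hle
    have h5 := geom_sum_mul_add a n
    have h6 := geom_sum_mul_add b m
    rw [← hX, h1, add_comm, mul_assoc, mul_comm _ a] at h5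
    rw [← hY, h2, add_comm, mul_assoc, mul_comm _ b] at h6
    have h7 := Nat.eq_of_mul_eq_mul_left (by omega) (Nat.add_left_cancel h5)
    have h8 := Nat.eq_of_mul_eq_mul_left (by omega) (Nat.add_left_cancel h6)
    have h9 : (b + 1) * κ ≤ (a + 1) * κ := by
      rw [← h7, ← h8]
      exact (sum_le_sum fun i _ => Nat.pow_le_pow_left hxy.le i).trans
        (sum_le_sum_of_subset (range_subset_range.mpr hle))
    have := Nat.le_of_mul_le_mul_right h9 hκ
    omega
  have hNX : X ≤ N := by
    rcases Nat.even_or_odd (b + 1) with hev | hodd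
    · have hxodd : Odd (a + 1) := by
        rw [← Nat.not_even_iff_odd]
        exact fun h => Nat.not_coprime_of_dvd_of_dvd (by norm_num) h.two_dvd hev.two_dvd hcop
      have hdvd : X ∣ M := by
        refine dvd_of_odd_of_pow_eq hY1 (hX ▸ hxodd.pow) hM (fun p hp hpX => ?_) h4
        rw [hX] at hpX
        rw [h2, Nat.add_sub_cancel_left]
        exact ((hp.dvd_of_dvd_pow hpX).mul_left _).mul_right _
      exact (Nat.le_of_dvd hM hdvd).trans hMN
    · have hdvd : Y ∣ N := by
        refine dvd_of_odd_of_pow_eq hX1 (hY ▸ hodd.pow) hN (fun p hp hpY => ?_) h3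
        rw [hY] at hpY
        rw [h1, Nat.add_sub_cancel_left]
        exact ((hp.dvd_of_dvd_pow hpY).mul_left _).mul_right _
      exact hXY.le.trans (Nat.le_of_dvd hN hdvd)
  have hW : (N + 1) * (m - 1) ≤ m * (M + 1) := by
    have h5 : (b + 1) ^ (m - 1) ≤ X := by
      have h6 : (b + 1) ^ (m - 1) * (b + 1) = Y := by
        rw [hY, ← pow_succ, Nat.sub_add_cancel (by omega)]
      nlinarith
    have h7 : (b + 1) ^ ((N + 1) * (m - 1)) < (b + 1) ^ (m * (M + 1)) := by
      rw [pow_mul _ m, ← hY, mul_comm, pow_mul]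
      exact (Nat.pow_le_pow_left h5 _).trans_lt hlt
    exact ((Nat.pow_lt_pow_iff_right (by omega)).mp h7).le
  have hdvd : ((b + 1 : ℕ) : ℤ) ∣ X - 1 := by
    rw [h1]
    exact ⟨a * κ, by push_cast; ring⟩
  have hcong : ((b + 1 : ℕ) : ℤ) ^ (m * (M + 1)) ∣
      (b * (a + 1) : ℕ) * (X : ℤ) ^ (N + 1) - (b - a : ℕ) := by
    refine ⟨a * (b + 1), ?_⟩
    rw [pow_mul, ← Nat.cast_pow (b + 1), ← hY]
    have := congrArg (Nat.cast : ℕ → ℤ) hid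
    push_cast at this ⊢
    linear_combination this
  obtain ⟨hm40, hXb⟩ := lt_searchBound (y := b + 1) (q := N + 1) (by omega) hm2 (by omega)
    (hY ▸ hXY) (hY ▸ hYX) fun Q hQ => lt_of_mul_le_pow (by omega) hX1 hm2 (by omega)
      (Nat.mul_pos (by omega) (by omega)) hdvd (hY ▸ hXY.le) (by omega) (by nlinarith) hcong hW hQ
  obtain ⟨ha, hb, rfl, rfl⟩ := eq_of_lt_searchBound hx hxy hm2 hmn hm40 (hX ▸ h1) (hY ▸ h2)
    (hX ▸ hXb) (hX ▸ hY ▸ hYX)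
  obtain rfl : a = 1 := by omega
  obtain rfl : b = 4 := by omega
  subst hX hY
  norm_num at hid hNX
  exact two_mul_eq_add_pow_absurd (by omega) hid

theorem pow_gcd_eq {a s i i' t t' : ℕ} (h : a ^ i = 1 + s * t) (h' : a ^ i' = 1 + s * t') :
    a ^ i.gcd i' = 1 + s * t.gcd t' := by
  have h5 := Nat.pow_sub_one_gcd_pow_sub_one a i i'
  rw [h, h', Nat.add_sub_cancel_left, Nat.add_sub_cancel_left, Nat.gcd_mul_left] at h5
  have h6 : 0 < a ^ i.gcd i' := by
    rcases Nat.eq_zero_or_pos a with rfl | ha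
    · rcases Nat.eq_zero_or_pos i with rfl | hi
      · rcases Nat.eq_zero_or_pos i' with rfl | hi'
        · simp
        · rw [zero_pow hi'.ne'] at h'; omega
      · rw [zero_pow hi.ne'] at h; omega
    · positivity
  omega

theorem padicValNat_eq_of_pow_mul_eq {p x N d U : ℕ} [hp : Fact p.Prime] (hx : 2 ≤ x)
    (hpx : p ∣ x) (hd : 0 < d) (h : x ^ N * (x ^ d - 1) = (x - 1) * U) :
    padicValNat p U = N * padicValNat p x := by
  have hnd : ∀ d, 0 < d → x ^ d - 1 ≠ 0 ∧ padicValNat p (x ^ d - 1) = 0 := by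
    intro d hd
    have h1 : 1 < x ^ d := Nat.one_lt_pow hd.ne' hx
    refine ⟨by omega, padicValNat.eq_zero_of_not_dvd fun h' => hp.out.one_lt.ne' ?_⟩
    have := Nat.dvd_sub (hpx.trans (dvd_pow_self x hd.ne')) h'
    rw [Nat.sub_sub_self h1.le] at this
    exact Nat.dvd_one.mp this
  have hd' := hnd d hd
  have h1' := hnd 1 one_pos
  rw [pow_one] at h1'
  have hxN : x ^ N ≠ 0 := by positivity
  have hU : U ≠ 0 := by
    rintro rfl
    exact mul_ne_zero hxN hd'.1 (by simpa using h)
  have := congrArg (padicValNat p) h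
  rw [padicValNat.mul hxN hd'.1, padicValNat.mul h1'.1 hU, hd'.2, h1'.2,
    padicValNat.pow] at this
  omega

theorem pow_mul_pow_sub_one_eq {x M N u v : ℕ} (hMN : M ≤ N)
    (h1 : x ^ M = 1 + (x - 1) * u) (h2 : x ^ N = 1 + (x - 1) * v) :
    x ^ M * (x ^ (N - M) - 1) = (x - 1) * (v - u) := by
  rw [Nat.mul_sub, Nat.mul_sub, ← pow_add, Nat.add_sub_cancel' hMN, mul_one, h1, h2]
  omega

theorem lt_of_pow_eq {x M N u v : ℕ} (hx : 2 ≤ x) (h1 : x ^ M = 1 + (x - 1) * u)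
    (h2 : x ^ N = 1 + (x - 1) * v) : M < N ↔ u < v := by
  rw [← Nat.pow_lt_pow_iff_right (a := x) (by omega), h1, h2, Nat.add_lt_add_iff_left]
  exact Nat.mul_lt_mul_left (by omega)

/-- Two repunits to the non-coprime bases `x < y` coincide at most once nontrivially. -/
theorem coprime_of_two_repunit_solutions {x y N M N' M' u u' : ℕ} (hx : 2 ≤ x) (hxy : x < y)
    (hN : 2 ≤ N) (hNN : N < N') (h1 : x ^ N = 1 + (x - 1) * u) (h2 : y ^ M = 1 + (y - 1) * u)
    (h3 : x ^ N' = 1 + (x - 1) * u') (h4 : y ^ M' = 1 + (y - 1) * u') : x.Coprime y := by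
  by_contra hcop
  obtain ⟨p, hp, hpx, hpy⟩ := Nat.Prime.not_coprime_iff_dvd.mp hcop
  have := Fact.mk hp
  have huu : u < u' := (lt_of_pow_eq hx h1 h3).mp hNN
  have hMM : M < M' := (lt_of_pow_eq (by omega) h2 h4).mpr huu
  have h5 : x ^ 1 = 1 + (x - 1) * 1 := by rw [pow_one]; omega
  have h6 : y ^ 1 = 1 + (y - 1) * 1 := by rw [pow_one]; omega
  have hu : 1 < u := (lt_of_pow_eq hx h5 h1).mp hN
  have hM : 1 < M := (lt_of_pow_eq (by omega) h6 h2).mpr hu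
  have e1 := padicValNat_eq_of_pow_mul_eq hx hpx (by omega)
    (pow_mul_pow_sub_one_eq (by omega) h5 h1)
  have e2 := padicValNat_eq_of_pow_mul_eq (by omega) hpy (by omega)
    (pow_mul_pow_sub_one_eq hM.le h6 h2)
  have e3 := padicValNat_eq_of_pow_mul_eq hx hpx (by omega)
    (pow_mul_pow_sub_one_eq hNN.le h1 h3)
  have e4 := padicValNat_eq_of_pow_mul_eq (by omega) hpy (by omega)
    (pow_mul_pow_sub_one_eq hMM.le h2 h4)
  have hv : 0 < padicValNat p x := (one_le_padicValNat_of_dvd (by omega) hpx)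
  have hvv : padicValNat p x = padicValNat p y := by omega
  rw [e3, hvv] at e4
  obtain rfl : N = M := Nat.eq_of_mul_eq_mul_right (hvv ▸ hv) e4
  have g : ∀ z, 2 ≤ z → z ^ N = 1 + (z - 1) * u → u = ∑ i ∈ range N, z ^ i := by
    intro z hz h
    obtain ⟨w, rfl⟩ : ∃ w, z = w + 1 := ⟨z - 1, by omega⟩
    have := geom_sum_mul_add w N
    rw [h, Nat.add_sub_cancel, add_comm, mul_comm] at this
    exact (Nat.eq_of_mul_eq_mul_left (by omega) (Nat.add_left_cancel this)).symm
  have hlt : ∑ i ∈ range N, x ^ i < ∑ i ∈ range N, y ^ i :=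
    sum_lt_sum (fun i _ => Nat.pow_le_pow_left hxy.le i) 
      ⟨1, mem_range.mpr hN, by simpa using hxy⟩
  rw [← g x hx h1, ← g y (by omega) h2] at hlt
  exact lt_irrefl _ hlt

/-- The equation `(x ^ N - 1) / (x - 1) = (y ^ M - 1) / (y - 1)` has at most one solution with
`N ≥ 2`. -/
theorem repunit_solution_unique {x y N M N' M' u u' : ℕ} (hx : 2 ≤ x) (hxy : x < y)
    (hN : 2 ≤ N) (hNN : N < N') (h1 : x ^ N = 1 + (x - 1) * u) (h2 : y ^ M = 1 + (y - 1) * u)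
    (h3 : x ^ N' = 1 + (x - 1) * u') (h4 : y ^ M' = 1 + (y - 1) * u') : False := by
  classical
  have hcop := coprime_of_two_repunit_solutions hx hxy hN hNN h1 h2 h3 h4
  have hex : ∃ N, 2 ≤ N ∧ ∃ M u, x ^ N = 1 + (x - 1) * u ∧ y ^ M = 1 + (y - 1) * u :=
    ⟨N, hN, M, u, h1, h2⟩
  obtain ⟨N₀, hN₀, hmin⟩ : ∃ N₀, (2 ≤ N₀ ∧ ∃ M u, x ^ N₀ = 1 + (x - 1) * u ∧
      y ^ M = 1 + (y - 1) * u) ∧ ∀ N, 2 ≤ N → (∃ M u, x ^ N = 1 + (x - 1) * u ∧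
      y ^ M = 1 + (y - 1) * u) → N₀ ≤ N :=
    ⟨Nat.find hex, Nat.find_spec hex, fun N h h' => Nat.find_min' hex ⟨h, h'⟩⟩
  replace hNN : N₀ < N' := (hmin N hN ⟨M, u, h1, h2⟩).trans_lt hNN
  clear h1 h2 hN hex
  obtain ⟨hN, M, u, h1, h2⟩ := hN₀
  have hy : 2 ≤ y := by omega
  have huu : u < u' := (lt_of_pow_eq hx h1 h3).mp hNN
  have hMM : M < M' := (lt_of_pow_eq hy h2 h4).mpr huu
  have h5 : x ^ 1 = 1 + (x - 1) * 1 := by rw [pow_one]; omega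
  have h6 : y ^ 1 = 1 + (y - 1) * 1 := by rw [pow_one]; omega
  have hu : 1 < u := (lt_of_pow_eq hx h5 h1).mp hN
  have hM : 1 < M := (lt_of_pow_eq hy h6 h2).mpr hu
  have hcx : x.Coprime (x - 1) :=
    (Nat.coprime_self_sub_right (by omega)).mpr (Nat.coprime_one_right x)
  have hcy : y.Coprime (y - 1) :=
    (Nat.coprime_self_sub_right (by omega)).mpr (Nat.coprime_one_right y)
  have factor : ∀ {n m d e U : ℕ}, x ^ n * (x ^ d - 1) = (x - 1) * U →
      y ^ m * (y ^ e - 1) = (y - 1) * U →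
      ∃ k, x ^ d = 1 + (x - 1) * (y ^ m * k) ∧ y ^ e = 1 + (y - 1) * (x ^ n * k) := by
    intro n m d e U hU1 hU2
    have hdx : x ^ n ∣ U := (hcx.pow_left n).dvd_of_dvd_mul_left ⟨_, hU1.symm⟩
    have hdy : y ^ m ∣ U := (hcy.pow_left m).dvd_of_dvd_mul_left ⟨_, hU2.symm⟩
    obtain ⟨k, rfl⟩ := Nat.Coprime.mul_dvd_of_dvd_of_dvd (hcop.pow n m) hdx hdy
    refine ⟨k, ?_, ?_⟩
    · have : x ^ d - 1 = (x - 1) * (y ^ m * k) :=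
        Nat.eq_of_mul_eq_mul_left (show 0 < x ^ n by positivity) (by rw [hU1]; ring)
      have := Nat.one_le_pow d x (by omega)
      omega
    · have : y ^ e - 1 = (y - 1) * (x ^ n * k) :=
        Nat.eq_of_mul_eq_mul_left (show 0 < y ^ m by positivity) (by rw [hU2]; ring)
      have := Nat.one_le_pow e y (by omega)
      omega
  obtain ⟨κ, hκ1, hκ2⟩ := factor (pow_mul_pow_sub_one_eq (by omega) h5 h1)
    (pow_mul_pow_sub_one_eq hM.le h6 h2)
  obtain ⟨k, hk1, hk2⟩ := factor (pow_mul_pow_sub_one_eq hNN.le h1 h3)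
    (pow_mul_pow_sub_one_eq hMM.le h2 h4)
  obtain ⟨n, rfl⟩ : ∃ n, N₀ = n + 1 := ⟨N₀ - 1, by omega⟩
  obtain ⟨m, rfl⟩ : ∃ m, M = m + 1 := ⟨M - 1, by omega⟩
  simp only [Nat.add_sub_cancel, pow_one] at hκ1 hκ2
  generalize hd : N' - (n + 1) = d at hk1
  generalize he : M' - (m + 1) = e at hk2
  obtain ⟨l, hl1, hl2⟩ : ∃ l, x ^ n.gcd d = 1 + (x - 1) * y * l ∧
      y ^ m.gcd e = 1 + (y - 1) * x * l := by
    have cop : ∀ {z N w : ℕ}, z ^ N = 1 + w * κ → κ.gcd (z ^ N * k) = κ.gcd k := by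
      intro z N w h
      refine Nat.Coprime.gcd_mul_left_cancel_right k ?_
      rw [h, Nat.coprime_add_mul_right_left]
      exact Nat.coprime_one_left κ
    refine ⟨κ.gcd k, ?_, ?_⟩
    · rw [← cop (z := y) (N := m) (w := (y - 1) * x) (by rw [hκ2]; ring)]
      exact pow_gcd_eq (by rw [hκ1]; ring) (by rw [hk1]; ring)
    · rw [← cop (z := x) (N := n) (w := (x - 1) * y) (by rw [hκ1]; ring)]
      exact pow_gcd_eq (by rw [hκ2]; ring) (by rw [hk2]; ring)
  have hgn : n ≤ n.gcd d := by
    have hgpos : 0 < n.gcd d := Nat.gcd_pos_of_pos_left _ (by omega)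
    have := hmin (n.gcd d + 1) (by omega) ⟨m.gcd e + 1, 1 + x * y * l, ?_, ?_⟩
    · omega
    · rw [pow_succ, hl1]
      obtain ⟨a, rfl⟩ : ∃ a, x = a + 1 := ⟨x - 1, by omega⟩
      simp only [Nat.add_sub_cancel]; ring
    · rw [pow_succ, hl2]
      obtain ⟨b, rfl⟩ : ∃ b, y = b + 1 := ⟨y - 1, by omega⟩
      simp only [Nat.add_sub_cancel]; ring
  have hgn' : n.gcd d = n := le_antisymm (Nat.gcd_le_left _ (by omega)) hgn
  have hlκ : l = κ := by
    rw [hgn', hκ1] at hl1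
    have : (x - 1) * y * κ = (x - 1) * y * l := by rw [mul_assoc]; omega
    exact (Nat.eq_of_mul_eq_mul_left (Nat.mul_pos (by omega) (by omega)) this).symm
  have hgm' : m.gcd e = m := by
    refine Nat.pow_right_injective hy ?_
    show y ^ m.gcd e = y ^ m
    rw [hl2, hκ2, hlκ]; ring
  obtain ⟨P, hP⟩ : n ∣ d := hgn' ▸ Nat.gcd_dvd_right n d
  obtain ⟨R, hR⟩ : m ∣ e := hgm' ▸ Nat.gcd_dvd_right m e
  have hPpos : 0 < P := Nat.pos_of_ne_zero (by rintro rfl; omega)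
  have hRpos : 0 < R := Nat.pos_of_ne_zero (by rintro rfl; omega)
  have hκk : κ ∣ k := by
    have d1 : κ ∣ y ^ m * k := by
      have h7 : x ^ n - 1 ∣ x ^ d - 1 := Nat.pow_sub_one_dvd_pow_sub_one x ⟨P, hP⟩
      rw [hκ1, hk1, Nat.add_sub_cancel_left, Nat.add_sub_cancel_left] at h7
      have h8 := Nat.dvd_of_mul_dvd_mul_left (by omega) h7
      rw [pow_succ', mul_assoc] at h8
      exact Nat.dvd_of_mul_dvd_mul_left (by omega) h8
    have d2 : κ ∣ x ^ n * k := by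
      have h7 : y ^ m - 1 ∣ y ^ e - 1 := Nat.pow_sub_one_dvd_pow_sub_one y ⟨R, hR⟩
      rw [hκ2, hk2, Nat.add_sub_cancel_left, Nat.add_sub_cancel_left] at h7
      have h8 := Nat.dvd_of_mul_dvd_mul_left (by omega) h7
      rw [pow_succ', mul_assoc] at h8
      exact Nat.dvd_of_mul_dvd_mul_left (by omega) h8
    have := Nat.dvd_gcd d1 d2
    rwa [Nat.gcd_mul_right, (hcop.symm.pow m n).gcd_eq_one, one_mul] at this
  obtain ⟨κ', rfl⟩ := hκk
  refine repunit_system_absurd (n := n) (m := m) (N := P) (M := R) (κ := κ) (κ' := κ') hx hxy hcop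
    (by omega) (by omega) hPpos hRpos (by rw [hκ1]; ring) (by rw [hκ2]; ring) ?_ ?_
  · rw [← pow_mul, ← hP, hk1, hκ1, Nat.add_sub_cancel_left]
    ring
  · rw [← pow_mul, ← hR, hk2, hκ2, Nat.add_sub_cancel_left]
    ring

theorem not_three_solutions {a b r s : ℕ} (ha : 2 ≤ a) (hb : 2 ≤ b) (hs : 0 < s) (hsr : s < r)
    {i j t : Fin 3 → ℕ} (hi : ∀ l, 0 < i l) (hinj : Function.Injective i)
    (h1 : ∀ l, a ^ i l = 1 + s * t l) (h2 : ∀ l, b ^ j l = 1 + r * t l) : False := by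
  classical
  have hex : ∃ n, 0 < n ∧ ∃ m k, a ^ n = 1 + s * k ∧ b ^ m = 1 + r * k :=
    ⟨i 0, hi 0, j 0, t 0, h1 0, h2 0⟩
  obtain ⟨n, ⟨hn, m, k, hk1, hk2⟩, hmin⟩ : ∃ n, (0 < n ∧ ∃ m k, a ^ n = 1 + s * k ∧
      b ^ m = 1 + r * k) ∧ ∀ n', 0 < n' → (∃ m k, a ^ n' = 1 + s * k ∧ b ^ m = 1 + r * k) →
      n ≤ n' :=
    ⟨Nat.find hex, Nat.find_spec hex, fun n h h' => Nat.find_min' hex ⟨h, h'⟩⟩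
  have hkpos : 0 < k := Nat.pos_of_ne_zero (by
    rintro rfl
    have := Nat.one_lt_pow hn.ne' ha
    simp at hk1; omega)
  have hsk : 0 < s * k := Nat.mul_pos hs hkpos
  have key : ∀ l, ∃ N M u, i l = n * N ∧ (a ^ n) ^ N = 1 + (a ^ n - 1) * u ∧
      (b ^ m) ^ M = 1 + (b ^ m - 1) * u := by
    intro l
    obtain ⟨k', h3, h4⟩ : ∃ k', a ^ n.gcd (i l) = 1 + s * k' ∧ b ^ m.gcd (j l) = 1 + r * k' :=
      ⟨_, pow_gcd_eq hk1 (h1 l), pow_gcd_eq hk2 (h2 l)⟩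
    have hg : n.gcd (i l) = n := le_antisymm (Nat.gcd_le_left _ hn)
      (hmin _ (Nat.gcd_pos_of_pos_left _ hn) ⟨_, _, h3, h4⟩)
    have hkk : k' = k := by
      rw [hg, hk1] at h3
      exact (Nat.eq_of_mul_eq_mul_left hs (Nat.add_left_cancel h3)).symm
    have hg' : m.gcd (j l) = m := by
      refine Nat.pow_right_injective hb ?_
      show b ^ m.gcd (j l) = b ^ m
      rw [h4, hk2, hkk]
    obtain ⟨N, hN⟩ : n ∣ i l := hg ▸ Nat.gcd_dvd_right n (i l)
    obtain ⟨M, hM⟩ : m ∣ j l := hg' ▸ Nat.gcd_dvd_right m (j l)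
    obtain ⟨u, hu⟩ : k ∣ t l := by
      have h7 : a ^ n - 1 ∣ a ^ i l - 1 := Nat.pow_sub_one_dvd_pow_sub_one a ⟨N, hN⟩
      rw [hk1, h1, Nat.add_sub_cancel_left, Nat.add_sub_cancel_left] at h7
      exact Nat.dvd_of_mul_dvd_mul_left hs h7
    refine ⟨N, M, u, hN, ?_, ?_⟩
    · rw [← pow_mul, ← hN, h1, hk1, Nat.add_sub_cancel_left, hu, mul_assoc]
    · rw [← pow_mul, ← hM, h2, hk2, Nat.add_sub_cancel_left, hu, mul_assoc]
  choose N M u hN hx hy using key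
  have hNpos : ∀ l, 0 < N l := fun l => Nat.pos_of_ne_zero fun h => by
    have := hi l; rw [hN, h] at this; omega
  have hNinj : ∀ l l', l ≠ l' → N l ≠ N l' := fun l l' h h' =>
    h (hinj (by rw [hN, hN, h']))
  have hxy : a ^ n < b ^ m := by
    rw [hk1, hk2]
    exact Nat.add_lt_add_left (Nat.mul_lt_mul_of_pos_right hsr hkpos) 1
  have habs : ∀ l l', 2 ≤ N l → N l < N l' → False := fun l l' h h' =>
    repunit_solution_unique (by omega) hxy h h' (hx l) (hy l) (hx l') (hy l')
  have p0 := hNpos 0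
  have p1 := hNpos 1
  have p2 := hNpos 2
  have n01 := hNinj 0 1 (by decide)
  have n02 := hNinj 0 2 (by decide)
  have n12 := hNinj 1 2 (by decide)
  have q01 := habs 0 1
  have q10 := habs 1 0
  have q02 := habs 0 2
  have q20 := habs 2 0
  have q12 := habs 1 2
  have q21 := habs 2 1
  grind

theorem card_solutions_le_three {a b c r s : ℕ} (ha : 1 < a) (hb : 1 < b) (hc : 0 < c) (hs : 0 < s)
    {S : Finset (ℕ × ℕ)} (hS : ∀ p ∈ S, r * a ^ p.1 = c + s * b ^ p.2) : #S ≤ 3 := by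
  classical
  by_contra! hcard
  obtain ⟨T, hTS, hT⟩ := exists_subset_card_eq (show 4 ≤ #S by omega)
  replace hS : ∀ p ∈ T, r * a ^ p.1 = c + s * b ^ p.2 := fun p hp => hS p (hTS hp)
  obtain ⟨p₀, hp₀, hmin⟩ := T.exists_min_image Prod.fst (card_pos.mp (by omega))
  have hfst : ∀ p ∈ T, ∀ q ∈ T, p.1 = q.1 → p = q := by
    intro p hp q hq hpq
    have h1 := hS p hp
    rw [hpq, hS q hq] at h1
    exact Prod.ext hpq (Nat.pow_right_injective hb
      (Nat.eq_of_mul_eq_mul_left hs (Nat.add_left_cancel h1))).symm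
  obtain ⟨p₁, p₂, p₃, h12, h13, h23, hE⟩ :=
    card_eq_three.mp (show #(T.erase p₀) = 3 by rw [card_erase_of_mem hp₀, hT])
  let p : Fin 3 → ℕ × ℕ := ![p₁, p₂, p₃]
  have hpE : ∀ l, p l ∈ T.erase p₀ := by
    intro l
    rw [hE]
    fin_cases l <;> simp [p]
  have hpinj : Function.Injective p := by
    intro l l' h
    fin_cases l <;> fin_cases l' <;> simp_all [p]
  have hpT : ∀ l, p l ∈ T := fun l => mem_of_mem_erase (hpE l)
  have hlt : ∀ l, p₀.1 < (p l).1 := fun l =>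
    lt_of_le_of_ne (hmin _ (hpT l)) fun h => ne_of_mem_erase (hpE l) (hfst _ hp₀ _ (hpT l) h).symm
  have h0 := hS p₀ hp₀
  have hr : 0 < r := Nat.pos_of_ne_zero (by rintro rfl; omega)
  have hle : ∀ l, p₀.2 ≤ (p l).2 := by
    intro l
    have h1 : r * a ^ p₀.1 ≤ r * a ^ (p l).1 :=
      Nat.mul_le_mul_left _ (Nat.pow_le_pow_right (by omega) (hlt l).le)
    rw [h0, hS _ (hpT l), Nat.add_le_add_iff_left] at h1
    exact (Nat.pow_le_pow_iff_right hb).mp (Nat.le_of_mul_le_mul_left h1 hs)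
  have hB : 0 < s * b ^ p₀.2 := by positivity
  obtain ⟨d, r', s', hd, hcop, hr', hs'⟩ := Nat.exists_coprime' (m := r * a ^ p₀.1)
    (n := s * b ^ p₀.2) (Nat.gcd_pos_of_pos_right _ hB)
  have hs'pos : 0 < s' := Nat.pos_of_ne_zero (by rintro rfl; omega)
  have hsr : s' < r' := Nat.lt_of_mul_lt_mul_right (a := d) (by omega)
  have hex : ∀ l, ∃ t, a ^ ((p l).1 - p₀.1) = 1 + s' * t ∧ b ^ ((p l).2 - p₀.2) = 1 + r' * t := by
    intro l
    have h1 := hS _ (hpT l)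
    rw [← Nat.add_sub_cancel' (hlt l).le, ← Nat.add_sub_cancel' (hle l), pow_add, pow_add,
      ← mul_assoc, ← mul_assoc, hr', hs'] at h1
    rw [hr', hs'] at h0
    obtain ⟨u, hu⟩ : ∃ u, a ^ ((p l).1 - p₀.1) = 1 + u :=
      ⟨_, (Nat.add_sub_cancel' (Nat.one_le_pow _ _ (by omega))).symm⟩
    obtain ⟨v, hv⟩ : ∃ v, b ^ ((p l).2 - p₀.2) = 1 + v :=
      ⟨_, (Nat.add_sub_cancel' (Nat.one_le_pow _ _ (by omega))).symm⟩
    rw [hu, hv] at h1 ⊢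
    have h2 : r' * u = s' * v := Nat.eq_of_mul_eq_mul_left hd (by nlinarith)
    obtain ⟨t, rfl⟩ : s' ∣ u := hcop.symm.dvd_of_dvd_mul_left ⟨v, h2⟩
    have h3 : v = r' * t := Nat.eq_of_mul_eq_mul_left hs'pos (by rw [← h2]; ring)
    exact ⟨t, rfl, by rw [h3]⟩
  choose t ht1 ht2 using hex
  refine not_three_solutions ha hb hs'pos hsr (fun l => Nat.sub_pos_of_lt (hlt l)) ?_ ht1 ht2
  intro l l' h
  have h1 := hlt l
  have h2 := hlt l'
  exact hpinj (hfst _ (hpT l) _ (hpT l') (by dsimp only at h; omega))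

end

theorem stmt_8 (a b c r s : ℤ)
    (ha : 1 < a) (hb : 1 < b) (hc : 0 < c) (hr : 0 < r) (hs : 0 < s) :
    {p : ℕ × ℕ | r * a ^ p.1 - s * b ^ p.2 = c}.encard ≤ 3 := by
  by_contra! h
  obtain ⟨T, hTS, hT⟩ := Set.exists_subset_encard_eq (Order.add_one_le_of_lt h)
  have hfin : T.Finite := Set.finite_of_encard_eq_coe (k := 4) (by rw [hT]; norm_num)
  lift a to ℕ using by omega
  lift b to ℕ using by omega
  lift c to ℕ using by omega
  lift r to ℕ using by omega
  lift s to ℕ using by omega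
  have h3 := card_solutions_le_three (a := a) (b := b) (c := c) (r := r) (s := s)
    (S := hfin.toFinset) (by omega) (by omega) (by omega) (by omega) fun p hp => by
      have : (r : ℤ) * a ^ p.1 - s * b ^ p.2 = c := hTS (hfin.mem_toFinset.mp hp)
      zify
      linarith
  rw [hfin.encard_eq_coe_toFinset_card] at hT
  have h4 : hfin.toFinset.card = 3 + 1 := by exact_mod_cast hT
  omega
end

section
/- Let a>1, b>1, c>0, r>0, s>0 be integers and suppose the equation r·a^x − s·b^y = c has three distinct solutions in nonnegative integers (x₁,y₁), (x₂,y₂), (x₃,y₃), where x₁ < x₂ < x₃ (so also y₁ < y₂ < y₃) and (x₁,y₁), (x₂,y₂) are the two least solutions. Set g₁ = gcd(x₂−x₁, x₃−x₁) and g₂ = gcd(y₂−y₁, y₃−y₁). Then r·a^(x₁)·(a^(g₁) − 1) = s·b^(y₁)·(b^(g₂) − 1); moreover g₁ = x₂ − x₁ and g₂ = y₂ − y₁. -/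
/-- The gcd of two numbers `A * (a ^ m - 1)` and `A * (a ^ n - 1)` has the same shape. -/
theorem Int.coe_gcd_mul_pow_sub_one {A a : ℤ} (hA : 0 ≤ A) (ha : 1 ≤ a) (m n : ℕ) :
    (Int.gcd (A * (a ^ m - 1)) (A * (a ^ n - 1)) : ℤ) = A * (a ^ Nat.gcd m n - 1) := by
  lift A to ℕ using hA
  lift a to ℕ using by omega
  have ha' : 1 ≤ a := by exact_mod_cast ha
  have cast_eq (k : ℕ) : (A : ℤ) * ((a : ℤ) ^ k - 1) = ((A * (a ^ k - 1) : ℕ) : ℤ) := by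
    rw [Nat.cast_mul, Nat.cast_sub (Nat.one_le_pow _ _ ha')]
    push_cast
    rfl
  rw [cast_eq, cast_eq, cast_eq, Int.gcd_natCast_natCast, Nat.gcd_mul_left,
    Nat.pow_sub_one_gcd_pow_sub_one]


theorem stmt_9 (a b c r s : ℤ)
    (ha : 1 < a) (hb : 1 < b) (hc : 0 < c) (hr : 0 < r) (hs : 0 < s)
    (x₁ y₁ x₂ y₂ x₃ y₃ : ℕ)
    (h1 : r * a ^ x₁ - s * b ^ y₁ = c)
    (h2 : r * a ^ x₂ - s * b ^ y₂ = c)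
    (h3 : r * a ^ x₃ - s * b ^ y₃ = c)
    (hx12 : x₁ < x₂) (hx23 : x₂ < x₃) (hy12 : y₁ < y₂) (hy23 : y₂ < y₃)
    -- `(x₁, y₁)` is the least solution
    (hleast₁ : ∀ x y : ℕ, r * a ^ x - s * b ^ y = c → x₁ ≤ x)
    -- `(x₂, y₂)` is the second least solution
    (hleast₂ : ∀ x y : ℕ, r * a ^ x - s * b ^ y = c → (x = x₁ ∧ y = y₁) ∨ x₂ ≤ x) :
    r * a ^ x₁ * (a ^ Nat.gcd (x₂ - x₁) (x₃ - x₁) - 1) =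
        s * b ^ y₁ * (b ^ Nat.gcd (y₂ - y₁) (y₃ - y₁) - 1) ∧
      Nat.gcd (x₂ - x₁) (x₃ - x₁) = x₂ - x₁ ∧
      Nat.gcd (y₂ - y₁) (y₃ - y₁) = y₂ - y₁ := by
  have split {r s a b : ℤ} {x y x' y' : ℕ} (hx : x ≤ x') (hy : y ≤ y')
      (h : r * a ^ x - s * b ^ y = c) (h' : r * a ^ x' - s * b ^ y' = c) :
      r * a ^ x * (a ^ (x' - x) - 1) = s * b ^ y * (b ^ (y' - y) - 1) := by
    obtain ⟨k, rfl⟩ := Nat.exists_eq_add_of_le hx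
    obtain ⟨l, rfl⟩ := Nat.exists_eq_add_of_le hy
    simp only [Nat.add_sub_cancel_left]
    rw [pow_add, pow_add] at h'
    linear_combination h' - h
  have key : r * a ^ x₁ * (a ^ Nat.gcd (x₂ - x₁) (x₃ - x₁) - 1) =
      s * b ^ y₁ * (b ^ Nat.gcd (y₂ - y₁) (y₃ - y₁) - 1) := by
    rw [← Int.coe_gcd_mul_pow_sub_one (by positivity) ha.le,
      ← Int.coe_gcd_mul_pow_sub_one (by positivity) hb.le,
      split hx12.le hy12.le h1 h2, split (hx12.trans hx23).le (hy12.trans hy23).le h1 h3]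
  have sol : r * a ^ (x₁ + Nat.gcd (x₂ - x₁) (x₃ - x₁)) -
      s * b ^ (y₁ + Nat.gcd (y₂ - y₁) (y₃ - y₁)) = c := by
    rw [pow_add, pow_add]
    linear_combination key + h1
  have hpos : 0 < Nat.gcd (x₂ - x₁) (x₃ - x₁) := Nat.gcd_pos_of_pos_left _ (by omega)
  have hle : Nat.gcd (x₂ - x₁) (x₃ - x₁) ≤ x₂ - x₁ := Nat.gcd_le_left _ (by omega)
  have hge : x₂ ≤ x₁ + Nat.gcd (x₂ - x₁) (x₃ - x₁) := by
    rcases hleast₂ _ _ sol with h | h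
    · omega
    · exact h
  have hx : x₁ + Nat.gcd (x₂ - x₁) (x₃ - x₁) = x₂ := by omega
  refine ⟨key, by omega, ?_⟩
  rw [hx] at sol
  have hpow : b ^ (y₁ + Nat.gcd (y₂ - y₁) (y₃ - y₁)) = b ^ y₂ :=
    mul_left_cancel₀ hs.ne' (by linear_combination h2 - sol)
  have hy := pow_right_injective₀ (by omega : 0 < b) hb.ne' hpow
  omega
end

section
/- Let a>1, b>1, c>0, r>0, s>0 be integers and suppose the equation r·a^x − s·b^y = c has three distinct solutions in nonnegative integers (x₁,y₁), (x₂,y₂), (x₃,y₃), where x₁ < x₂ < x₃ (so also y₁ < y₂ < y₃) and (x₁,y₁), (x₂,y₂) are the two least solutions. Then (x₂−x₁) divides (x₃−x₁), (y₂−y₁) divides (y₃−y₁), and setting A = a^(x₂−x₁), B = b^(y₂−y₁), m = (x₃−x₁)/(x₂−x₁), n = (y₃−y₁)/(y₂−y₁), one has A>1, B>1, m>1, n>1, and (A^m − 1)/(A − 1) = (B^n − 1)/(B − 1). -/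
theorem Int.gcd_pow_sub_one {a : ℤ} (ha : 1 < a) (d e : ℕ) :
    (Int.gcd (a ^ d - 1) (a ^ e - 1) : ℤ) = a ^ Nat.gcd d e - 1 := by
  lift a to ℕ using by lia
  have hcast (k : ℕ) : ((a ^ k - 1 : ℕ) : ℤ) = (a : ℤ) ^ k - 1 := by
    rw [Nat.cast_sub (Nat.one_le_pow _ _ (by lia))]
    push_cast
    rfl
  rw [← hcast, ← hcast, ← hcast, Int.gcd_natCast_natCast, Nat.pow_sub_one_gcd_pow_sub_one]

theorem mul_pow_gcd_sub_one_eq {a b R S : ℤ} (ha : 1 < a) (hb : 1 < b) (hR : 0 < R) (hS : 0 < S)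
    {d e D E : ℕ} (hde : R * (a ^ d - 1) = S * (b ^ e - 1))
    (hDE : R * (a ^ D - 1) = S * (b ^ E - 1)) :
    R * (a ^ Nat.gcd d D - 1) = S * (b ^ Nat.gcd e E - 1) := by
  have h : Int.gcd (R * (a ^ d - 1)) (R * (a ^ D - 1)) =
      Int.gcd (S * (b ^ e - 1)) (S * (b ^ E - 1)) := by rw [hde, hDE]
  rw [Int.gcd_mul_left, Int.gcd_mul_left] at h
  have h' : (R.natAbs : ℤ) * Int.gcd (a ^ d - 1) (a ^ D - 1) =
      S.natAbs * Int.gcd (b ^ e - 1) (b ^ E - 1) := mod_cast h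
  rwa [Int.gcd_pow_sub_one ha, Int.gcd_pow_sub_one hb, Int.natAbs_of_nonneg hR.le,
    Int.natAbs_of_nonneg hS.le] at h'

theorem Nat.one_lt_div_of_dvd_of_lt {d D : ℕ} (h : d ∣ D) (hlt : d < D) :
    1 < D / d := by
  rwa [Nat.lt_div_iff_mul_lt' h, mul_one]

theorem Int.ediv_eq_ediv_of_dvd_of_mul_eq_mul {R S u v U V : ℤ}
    (hR : R ≠ 0) (hu : u ≠ 0) (hv : v ≠ 0) (huU : u ∣ U) (hvV : v ∣ V)
    (h : R * u = S * v) (h' : R * U = S * V) : U / u = V / v := by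
  obtain ⟨p, rfl⟩ := huU
  obtain ⟨q, rfl⟩ := hvV
  rw [Int.mul_ediv_cancel_left _ hu, Int.mul_ediv_cancel_left _ hv]
  refine mul_left_cancel₀ (mul_ne_zero hR hu) ?_
  linear_combination h' - q * h

theorem stmt_10 (a b c r s : ℤ)
    (ha : 1 < a) (hb : 1 < b) (hc : 0 < c) (hr : 0 < r) (hs : 0 < s)
    (x₁ y₁ x₂ y₂ x₃ y₃ : ℕ)
    (h1 : r * a ^ x₁ - s * b ^ y₁ = c)
    (h2 : r * a ^ x₂ - s * b ^ y₂ = c)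
    (h3 : r * a ^ x₃ - s * b ^ y₃ = c)
    (hx12 : x₁ < x₂) (hx23 : x₂ < x₃) (hy12 : y₁ < y₂) (hy23 : y₂ < y₃)
    -- `(x₁, y₁)` is the least solution
    (hleast₁ : ∀ x y : ℕ, r * a ^ x - s * b ^ y = c → x₁ ≤ x)
    -- `(x₂, y₂)` is the second least solution
    (hleast₂ : ∀ x y : ℕ, r * a ^ x - s * b ^ y = c → (x = x₁ ∧ y = y₁) ∨ x₂ ≤ x) :
    (x₂ - x₁) ∣ (x₃ - x₁) ∧ (y₂ - y₁) ∣ (y₃ - y₁) ∧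
      1 < a ^ (x₂ - x₁) ∧ 1 < b ^ (y₂ - y₁) ∧
      1 < (x₃ - x₁) / (x₂ - x₁) ∧ 1 < (y₃ - y₁) / (y₂ - y₁) ∧
      ((a ^ (x₂ - x₁)) ^ ((x₃ - x₁) / (x₂ - x₁)) - 1) / (a ^ (x₂ - x₁) - 1) =
        ((b ^ (y₂ - y₁)) ^ ((y₃ - y₁) / (y₂ - y₁)) - 1) / (b ^ (y₂ - y₁) - 1) := by
  obtain ⟨d, rfl⟩ := Nat.exists_eq_add_of_lt hx12
  obtain ⟨D, rfl⟩ := Nat.exists_eq_add_of_lt (hx12.trans hx23)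
  obtain ⟨e, rfl⟩ := Nat.exists_eq_add_of_lt hy12
  obtain ⟨E, rfl⟩ := Nat.exists_eq_add_of_lt (hy12.trans hy23)
  simp only [add_assoc, Nat.add_sub_cancel_left] at *
  have hd : 0 < d + 1 := d.succ_pos
  have he : 0 < e + 1 := e.succ_pos
  have hdD : d + 1 < D + 1 := by lia
  have heE : e + 1 < E + 1 := by lia
  generalize d + 1 = d at *
  generalize D + 1 = D at *
  generalize e + 1 = e at *
  generalize E + 1 = E at *
  have hR : 0 < r * a ^ x₁ := by positivity
  have hS : 0 < s * b ^ y₁ := by positivity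
  have hde : r * a ^ x₁ * (a ^ d - 1) = s * b ^ y₁ * (b ^ e - 1) := by
    rw [pow_add, pow_add] at h2
    linear_combination h2 - h1
  have hDE : r * a ^ x₁ * (a ^ D - 1) = s * b ^ y₁ * (b ^ E - 1) := by
    rw [pow_add, pow_add] at h3
    linear_combination h3 - h1
  have hgcd := mul_pow_gcd_sub_one_eq ha hb hR hS hde hDE
  have hg : Nat.gcd d D = d := by
    have hpos : 0 < Nat.gcd d D := Nat.gcd_pos_of_pos_left _ hd
    have hle : Nat.gcd d D ≤ d := Nat.gcd_le_left _ hd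
    have hsol : r * a ^ (x₁ + Nat.gcd d D) - s * b ^ (y₁ + Nat.gcd e E) = c := by
      rw [pow_add, pow_add]
      linear_combination hgcd + h1
    have := hleast₂ _ _ hsol
    lia
  have hh : Nat.gcd e E = e := by
    rw [hg, hde] at hgcd
    have := mul_left_cancel₀ hS.ne' hgcd
    exact (pow_right_injective₀ (by lia) hb.ne' (sub_left_injective this)).symm
  have hdvd : d ∣ D := Nat.gcd_eq_left_iff_dvd.mp hg
  have hedvd : e ∣ E := Nat.gcd_eq_left_iff_dvd.mp hh
  have hA : 1 < a ^ d := one_lt_pow₀ ha hd.ne'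
  have hB : 1 < b ^ e := one_lt_pow₀ hb he.ne'
  refine ⟨hdvd, hedvd, hA, hB, Nat.one_lt_div_of_dvd_of_lt hdvd hdD,
    Nat.one_lt_div_of_dvd_of_lt hedvd heE, ?_⟩
  have hsub (u : ℤ) (k : ℕ) : u - 1 ∣ u ^ k - 1 := by simpa using sub_dvd_pow_sub_pow u 1 k
  refine Int.ediv_eq_ediv_of_dvd_of_mul_eq_mul hR.ne' (sub_ne_zero.mpr hA.ne')
    (sub_ne_zero.mpr hB.ne') (hsub _ _) (hsub _ _) hde ?_
  rwa [← pow_mul, ← pow_mul, Nat.mul_div_cancel' hdvd, Nat.mul_div_cancel' hedvd]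
end
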